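/- arXiv:math/0312256 — 8 statements merged into one kernel-verified Lean document; each statement's English description precedes it below -/
import Mathlib

section
/- Let γ > 1, ρ > 0, u ∈ ℝ, and define w(ρ,u) := (√Δ + (2γ−1)u)^{(2γ−1)/(2γ−2)} · (√Δ − (2γ−2)u), where Δ := (2γ−1)²u² + 4ρ (note √Δ > |(2γ−1)u| so the base of the power is positive). Then the gradient of w is a left eigenvector of D with eigenvalue λ: (w_ρ, w_u) · D = λ · (w_ρ, w_u), i.e. w is a Riemann invariant of the first characteristic family. Moreover z(ρ,u) := w(ρ,−u) satisfies (z_ρ, z_u) · D = μ · (z_ρ, z_u). -/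
/-- Discriminant Δ = (2γ−1)²u² + 4ρ. -/
noncomputable def disc (γ ρ u : ℝ) : ℝ := (2*γ-1)^2 * u^2 + 4*ρ

/-- The eigenvalue λ = ((2γ+1)u + √Δ)/2. -/
noncomputable def lam (γ ρ u : ℝ) : ℝ := ((2*γ+1)*u + Real.sqrt (disc γ ρ u)) / 2

/-- The eigenvalue μ = ((2γ+1)u − √Δ)/2. -/
noncomputable def muEV (γ ρ u : ℝ) : ℝ := ((2*γ+1)*u - Real.sqrt (disc γ ρ u)) / 2

/-- Jacobian matrix of the flux map (ρ,u) ↦ (ρu, ρ + γu²). -/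
noncomputable def Dmat (γ ρ u : ℝ) : Matrix (Fin 2) (Fin 2) ℝ := !![u, ρ; 1, 2*γ*u]

/-- The Riemann invariant
w(ρ,u) = (√Δ + (2γ−1)u)^{(2γ−1)/(2γ−2)} · (√Δ − (2γ−2)u). -/
noncomputable def wRiem (γ ρ u : ℝ) : ℝ :=
  (Real.sqrt (disc γ ρ u) + (2*γ-1)*u) ^ ((2*γ-1)/(2*γ-2)) *
    (Real.sqrt (disc γ ρ u) - (2*γ-2)*u)

/-- The other Riemann invariant z(ρ,u) := w(ρ,−u). -/
noncomputable def zRiem (γ ρ u : ℝ) : ℝ := wRiem γ ρ (-u)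

/-- The discriminant strictly dominates its first summand when `ρ > 0`. -/
theorem abs_mul_lt_sqrt_disc (γ u : ℝ) {ρ : ℝ} (hρ : 0 < ρ) :
    |(2*γ-1)*u| < Real.sqrt (disc γ ρ u) := by
  apply Real.lt_sqrt_of_sq_lt
  rw [sq_abs, disc]
  nlinarith

theorem disc_pos (γ u : ℝ) {ρ : ℝ} (hρ : 0 < ρ) : 0 < disc γ ρ u := by
  unfold disc
  positivity

theorem sqrt_disc_add_pos (γ u : ℝ) {ρ : ℝ} (hρ : 0 < ρ) :
    0 < Real.sqrt (disc γ ρ u) + (2*γ-1)*u := by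
  linarith [(abs_lt.mp (abs_mul_lt_sqrt_disc γ u hρ)).1]

theorem hasDerivAt_sqrt_disc_fst (γ u : ℝ) {ρ : ℝ} (hρ : 0 < ρ) :
    HasDerivAt (fun r => Real.sqrt (disc γ r u)) (2 / Real.sqrt (disc γ ρ u)) ρ := by
  have h : HasDerivAt (fun r => disc γ r u) 4 ρ := by
    simpa [disc] using ((hasDerivAt_id ρ).const_mul 4).const_add ((2*γ-1)^2 * u^2)
  convert h.sqrt (disc_pos γ u hρ).ne' using 1
  field_simp
  norm_num

theorem hasDerivAt_sqrt_disc_snd (γ u : ℝ) {ρ : ℝ} (hρ : 0 < ρ) :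
    HasDerivAt (fun v => Real.sqrt (disc γ ρ v))
      ((2*γ-1)^2 * u / Real.sqrt (disc γ ρ u)) u := by
  have h : HasDerivAt (fun v => disc γ ρ v) ((2*γ-1)^2 * (2*u)) u := by
    simpa [disc] using ((hasDerivAt_pow 2 u).const_mul ((2*γ-1)^2)).add_const (4*ρ)
  convert h.sqrt (disc_pos γ u hρ).ne' using 1
  field_simp

theorem hasDerivAt_wRiem_fst {γ ρ : ℝ} (u : ℝ) (hγ : 1 < γ) (hρ : 0 < ρ) :
    HasDerivAt (fun r => wRiem γ r u)
      (2 * ((2*γ-1)/(2*γ-2) + 1) *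
        (Real.sqrt (disc γ ρ u) + (2*γ-1)*u) ^ ((2*γ-1)/(2*γ-2) - 1)) ρ := by
  have hs := hasDerivAt_sqrt_disc_fst γ u hρ
  have hA := sqrt_disc_add_pos γ u hρ
  have hs0 := Real.sqrt_pos.mpr (disc_pos γ u hρ)
  have hc : 2*γ-2 ≠ 0 := by linarith
  have h := ((hs.add_const ((2*γ-1)*u)).rpow_const (p := (2*γ-1)/(2*γ-2))
    (Or.inl hA.ne')).mul (hs.sub_const ((2*γ-2)*u))
  refine h.congr_deriv ?_
  have hk : (2*γ-1)/(2*γ-2) * (2*γ-2) = 2*γ-1 := div_mul_cancel₀ _ hc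
  rw [Real.rpow_sub_one hA.ne']
  generalize (2*γ-1)/(2*γ-2) = k at *
  generalize (Real.sqrt (disc γ ρ u) + (2*γ-1)*u) ^ k = P
  generalize Real.sqrt (disc γ ρ u) = s at *
  field_simp
  linear_combination -(u * P) * hk

theorem hasDerivAt_wRiem_snd {γ ρ : ℝ} (u : ℝ) (hγ : 1 < γ) (hρ : 0 < ρ) :
    HasDerivAt (fun v => wRiem γ ρ v)
      (((2*γ-1)/(2*γ-2) + 1) *
        (Real.sqrt (disc γ ρ u) + (2*γ-1)*u) ^ ((2*γ-1)/(2*γ-2))) u := by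
  have hs := hasDerivAt_sqrt_disc_snd γ u hρ
  have hA := sqrt_disc_add_pos γ u hρ
  have hs0 := Real.sqrt_pos.mpr (disc_pos γ u hρ)
  have hc : 2*γ-2 ≠ 0 := by linarith
  have h := ((hs.add ((hasDerivAt_id u).const_mul (2*γ-1))).rpow_const
    (p := (2*γ-1)/(2*γ-2)) (Or.inl hA.ne')).mul
      (hs.sub ((hasDerivAt_id u).const_mul (2*γ-2)))
  refine h.congr_deriv ?_
  have hk : (2*γ-1)/(2*γ-2) * (2*γ-2) = 2*γ-1 := div_mul_cancel₀ _ hc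
  simp only [Pi.add_apply, Pi.sub_apply, id]
  rw [Real.rpow_sub_one hA.ne']
  generalize (2*γ-1)/(2*γ-2) = k at *
  generalize (Real.sqrt (disc γ ρ u) + (2*γ-1)*u) ^ k = P
  generalize Real.sqrt (disc γ ρ u) = s at *
  field_simp
  linear_combination P * (s^2 - ((2*γ-1)*u)^2) * hk

/-- A row vector whose first component equation holds by construction is a left eigenvector of
`Dmat` as soon as its eigenvalue is a root of the characteristic polynomial. -/
theorem vecMul_Dmat_eq_smul {γ ρ u a b l : ℝ} (hb : b = (l - u) * a)
    (hl : (l - u) * (l - 2*γ*u) = ρ) :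
    Matrix.vecMul ![a, b] (Dmat γ ρ u) = l • ![a, b] := by
  subst hb
  ext i
  fin_cases i
  · simp [Dmat, Matrix.vecMul, dotProduct, Fin.sum_univ_two]
    ring
  · simp [Dmat, Matrix.vecMul, dotProduct, Fin.sum_univ_two]
    linear_combination -a * hl

/-- For γ > 1 and ρ > 0: √Δ > |(2γ−1)u| (so the base of the power is
positive), the gradient of w is a left eigenvector of D with eigenvalue λ, and
the gradient of z(ρ,u) = w(ρ,−u) is a left eigenvector with eigenvalue μ. -/
theorem stmt_5 (γ ρ u : ℝ) (hγ : 1 < γ) (hρ : 0 < ρ) :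
    |(2*γ-1)*u| < Real.sqrt (disc γ ρ u) ∧
    Matrix.vecMul
        ![deriv (fun r => wRiem γ r u) ρ, deriv (fun v => wRiem γ ρ v) u]
        (Dmat γ ρ u)
      = lam γ ρ u •
          ![deriv (fun r => wRiem γ r u) ρ, deriv (fun v => wRiem γ ρ v) u] ∧
    Matrix.vecMul
        ![deriv (fun r => zRiem γ r u) ρ, deriv (fun v => zRiem γ ρ v) u]
        (Dmat γ ρ u)
      = muEV γ ρ u •
          ![deriv (fun r => zRiem γ r u) ρ, deriv (fun v => zRiem γ ρ v) u] := by
  have hsq (v : ℝ) := Real.sq_sqrt (disc_pos γ v hρ).le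
  have hneg : disc γ ρ (-u) = disc γ ρ u := by simp [disc]
  refine ⟨abs_mul_lt_sqrt_disc γ u hρ, vecMul_Dmat_eq_smul ?_ ?_, vecMul_Dmat_eq_smul ?_ ?_⟩
  · have hA := sqrt_disc_add_pos γ u hρ
    rw [(hasDerivAt_wRiem_fst u hγ hρ).deriv, (hasDerivAt_wRiem_snd u hγ hρ).deriv,
      Real.rpow_sub_one hA.ne', lam]
    field_simp
    ring
  · have h := hsq u
    rw [lam]
    conv_rhs at h => rw [disc]
    linear_combination h / 4
  · have hA := sqrt_disc_add_pos γ (-u) hρ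
    have hz : deriv (fun v => zRiem γ ρ v) u = -deriv (fun v => wRiem γ ρ v) (-u) :=
      deriv_comp_neg (fun v => wRiem γ ρ v) u
    rw [hz]
    simp only [zRiem]
    rw [(hasDerivAt_wRiem_fst (-u) hγ hρ).deriv, (hasDerivAt_wRiem_snd (-u) hγ hρ).deriv,
      muEV, ← hneg]
    generalize (2*γ-1)/(2*γ-2) = k
    rw [show k = k - 1 + 1 by ring, Real.rpow_add_one hA.ne', add_sub_cancel_right]
    ring
  · have h := hsq u
    rw [muEV]
    conv_rhs at h => rw [disc]
    linear_combination h / 4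
end

section
/- Fix γ ∈ ℝ and (ρ,u) with Δ := (2γ−1)²u² + 4ρ > 0, and let r := ((√Δ − (2γ−1)u)/2, 1)ᵀ and s := ((−√Δ − (2γ−1)u)/2, 1)ᵀ be the right eigenvectors of D for λ and μ respectively. Then 2√Δ · (∂_ρ λ, ∂_u λ) · r = (2γ+2)√Δ + (2γ−1)(2γ−2)u, and if γ ≠ −1 then (∂_ρ λ, ∂_u λ) · r = 0 implies ρ = −4γ(2γ−1)² u² / (2γ+2)². Consequently, for every γ ≥ 0 and every (ρ,u) ∈ (0,∞) × ℝ, both characteristic fields are genuinely nonlinear: (∂_ρ λ, ∂_u λ) · r ≠ 0 and (∂_ρ μ, ∂_u μ) · s ≠ 0. -/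
/-- (∂_ρ λ, ∂_u λ) · r, with r = ((√Δ − (2γ−1)u)/2, 1) the right eigenvector
for λ. -/
noncomputable def dotLam (γ ρ u : ℝ) : ℝ :=
  deriv (fun r => lam γ r u) ρ * ((Real.sqrt (disc γ ρ u) - (2*γ-1)*u)/2)
    + deriv (fun v => lam γ ρ v) u

/-- (∂_ρ μ, ∂_u μ) · s, with s = ((−√Δ − (2γ−1)u)/2, 1) the right eigenvector
for μ. -/
noncomputable def dotMu (γ ρ u : ℝ) : ℝ :=
  deriv (fun r => muEV γ r u) ρ * ((-Real.sqrt (disc γ ρ u) - (2*γ-1)*u)/2)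
    + deriv (fun v => muEV γ ρ v) u

theorem hasDerivAt_sqrt_disc_density {γ ρ u : ℝ} (hΔ : 0 < disc γ ρ u) :
    HasDerivAt (fun r => Real.sqrt (disc γ r u)) (4 / (2 * Real.sqrt (disc γ ρ u))) ρ := by
  have h : HasDerivAt (fun r => disc γ r u) 4 ρ := by
    simpa [disc] using ((hasDerivAt_id ρ).const_mul 4).const_add ((2*γ-1)^2 * u^2)
  exact h.sqrt hΔ.ne'

theorem hasDerivAt_sqrt_disc_velocity {γ ρ u : ℝ} (hΔ : 0 < disc γ ρ u) :
    HasDerivAt (fun v => Real.sqrt (disc γ ρ v))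
      ((2*γ-1)^2 * (2 * u) / (2 * Real.sqrt (disc γ ρ u))) u := by
  have h : HasDerivAt (fun v => disc γ ρ v) ((2*γ-1)^2 * (2 * u)) u := by
    simpa [disc] using ((hasDerivAt_pow 2 u).const_mul ((2*γ-1)^2)).add_const (4*ρ)
  exact h.sqrt hΔ.ne'

theorem two_sqrt_disc_mul_dotLam {γ ρ u : ℝ} (hΔ : 0 < disc γ ρ u) :
    2 * Real.sqrt (disc γ ρ u) * dotLam γ ρ u
      = (2*γ+2) * Real.sqrt (disc γ ρ u) + (2*γ-1)*(2*γ-2)*u := by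
  have hs := (Real.sqrt_pos.2 hΔ).ne'
  have hρ : deriv (fun r => lam γ r u) ρ = 4 / (2 * Real.sqrt (disc γ ρ u)) / 2 :=
    (((hasDerivAt_sqrt_disc_density hΔ).const_add ((2*γ+1)*u)).div_const 2).deriv
  have hu : deriv (fun v => lam γ ρ v) u = ((2*γ+1) * 1
      + (2*γ-1)^2 * (2 * u) / (2 * Real.sqrt (disc γ ρ u))) / 2 :=
    ((((hasDerivAt_id u).const_mul (2*γ+1)).add
      (hasDerivAt_sqrt_disc_velocity hΔ)).div_const 2).deriv
  rw [dotLam, hρ, hu]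
  field_simp
  ring

theorem two_sqrt_disc_mul_dotMu {γ ρ u : ℝ} (hΔ : 0 < disc γ ρ u) :
    2 * Real.sqrt (disc γ ρ u) * dotMu γ ρ u
      = (2*γ+2) * Real.sqrt (disc γ ρ u) - (2*γ-1)*(2*γ-2)*u := by
  have hs := (Real.sqrt_pos.2 hΔ).ne'
  have hρ : deriv (fun r => muEV γ r u) ρ = -(4 / (2 * Real.sqrt (disc γ ρ u))) / 2 :=
    (((hasDerivAt_sqrt_disc_density hΔ).const_sub ((2*γ+1)*u)).div_const 2).deriv
  have hu : deriv (fun v => muEV γ ρ v) u = ((2*γ+1) * 1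
      - (2*γ-1)^2 * (2 * u) / (2 * Real.sqrt (disc γ ρ u))) / 2 :=
    ((((hasDerivAt_id u).const_mul (2*γ+1)).sub
      (hasDerivAt_sqrt_disc_velocity hΔ)).div_const 2).deriv
  rw [dotMu, hρ, hu]
  field_simp
  ring

/-- Squaring `(2γ+2)√Δ = ±(2γ-1)(2γ-2)u` and clearing the common terms. -/
theorem density_mul_sq_eq {γ ρ u : ℝ} (hΔ : 0 < disc γ ρ u)
    (h : ((2*γ+2) * Real.sqrt (disc γ ρ u))^2 = ((2*γ-1)*(2*γ-2)*u)^2) :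
    ρ * (2*γ+2)^2 = -(4*γ*(2*γ-1)^2*u^2) := by
  rw [mul_pow, Real.sq_sqrt hΔ.le, disc] at h
  linear_combination h / 4

theorem density_mul_sq_eq_of_dotLam_eq_zero {γ ρ u : ℝ} (hΔ : 0 < disc γ ρ u)
    (h : dotLam γ ρ u = 0) : ρ * (2*γ+2)^2 = -(4*γ*(2*γ-1)^2*u^2) := by
  have key := two_sqrt_disc_mul_dotLam hΔ
  rw [h, mul_zero] at key
  refine density_mul_sq_eq hΔ ?_
  rw [← neg_sq ((2*γ-1)*(2*γ-2)*u)]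
  congr 1
  linarith

theorem density_mul_sq_eq_of_dotMu_eq_zero {γ ρ u : ℝ} (hΔ : 0 < disc γ ρ u)
    (h : dotMu γ ρ u = 0) : ρ * (2*γ+2)^2 = -(4*γ*(2*γ-1)^2*u^2) := by
  have key := two_sqrt_disc_mul_dotMu hΔ
  rw [h, mul_zero] at key
  refine density_mul_sq_eq hΔ ?_
  congr 1
  linarith

/-- Genuine nonlinearity computations: the explicit value of
2√Δ·(∇λ·r), the locus where ∇λ·r vanishes, and genuine nonlinearity of both
characteristic fields for γ ≥ 0 on (0,∞)×ℝ. -/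
theorem stmt_6 (γ ρ u : ℝ) (hΔ : 0 < disc γ ρ u) :
    (2 * Real.sqrt (disc γ ρ u) * dotLam γ ρ u
        = (2*γ+2) * Real.sqrt (disc γ ρ u) + (2*γ-1)*(2*γ-2)*u) ∧
    (γ ≠ -1 → dotLam γ ρ u = 0 → ρ = -(4*γ*(2*γ-1)^2*u^2) / (2*γ+2)^2) ∧
    (∀ γ' ρ' u' : ℝ, 0 ≤ γ' → 0 < ρ' → dotLam γ' ρ' u' ≠ 0 ∧ dotMu γ' ρ' u' ≠ 0) := by
  refine ⟨two_sqrt_disc_mul_dotLam hΔ, fun hγ h => ?_, fun γ' ρ' u' hγ hρ => ?_⟩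
  · have hne : 2*γ+2 ≠ 0 := fun h0 => hγ (by linarith)
    rw [eq_div_iff (pow_ne_zero 2 hne)]
    exact density_mul_sq_eq_of_dotLam_eq_zero hΔ h
  · have hd : 0 < disc γ' ρ' u' := by
      unfold disc
      positivity
    have hl : 0 < ρ' * (2*γ'+2)^2 := by positivity
    have hr : 0 ≤ 4*γ'*(2*γ'-1)^2*u'^2 := by positivity
    constructor
    · intro h
      linarith [density_mul_sq_eq_of_dotLam_eq_zero hd h]
    · intro h
      linarith [density_mul_sq_eq_of_dotMu_eq_zero hd h]
end

section
/- Under the stated conditions on the fluxes with γ > 1, there exist constants 0 < C₂ < C₁ < ∞ and r₀ > 0 such that for every r ∈ [0, r₀] the following holds: if σ is any solution of the characteristic ODE on an interval I containing 0, with σ(0) = r and (σ(u), u) ∈ D for u ∈ I, then r + C₁ √r · u ≤ σ(u) ≤ r + C₂ √r · u for u ∈ I with u ≤ 0, and r ≤ σ(u) ≤ r + C₁ · min( √r · u , r^{(4γ−3)/(4γ−2)} u^{1/(2γ−1)} ) for u ∈ I with u ≥ 0; moreover u ↦ σ(u) is monotone increasing. -/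
open Set

/-- First partial derivative (with respect to the first variable). -/
noncomputable def pd1 (f : ℝ → ℝ → ℝ) (x y : ℝ) : ℝ := deriv (fun x' => f x' y) x

/-- Second partial derivative (with respect to the second variable). -/
noncomputable def pd2 (f : ℝ → ℝ → ℝ) (x y : ℝ) : ℝ := deriv (fun y' => f x y') y

/-- Right-hand side of the characteristic ODE
dρ/du = (√((Φ_u−Ψ_ρ)² + 4Φ_ρΨ_u) − (Φ_u−Ψ_ρ)) / (2Φ_ρ). -/
noncomputable def charRHS (Ψ Φ : ℝ → ℝ → ℝ) (ρ u : ℝ) : ℝ :=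
  (Real.sqrt ((pd2 Φ ρ u - pd1 Ψ ρ u)^2 + 4 * pd1 Φ ρ u * pd2 Ψ ρ u)
    - (pd2 Φ ρ u - pd1 Ψ ρ u)) / (2 * pd1 Φ ρ u)

section PartialDerivatives

variable {f : ℝ → ℝ → ℝ}

theorem hasDerivAt_fst_of_contDiff (hf : ContDiff ℝ (⊤ : ℕ∞) (fun p : ℝ × ℝ => f p.1 p.2))
    (x y : ℝ) :
    HasDerivAt (fun x' => f x' y) (fderiv ℝ (fun p : ℝ × ℝ => f p.1 p.2) (x, y) (1, 0)) x := by
  have h := (hf.differentiable (by simp) (x, y)).hasFDerivAt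
  exact h.comp_hasDerivAt x ((hasDerivAt_id x).prodMk (hasDerivAt_const x y))

theorem hasDerivAt_snd_of_contDiff (hf : ContDiff ℝ (⊤ : ℕ∞) (fun p : ℝ × ℝ => f p.1 p.2))
    (x y : ℝ) :
    HasDerivAt (fun y' => f x y') (fderiv ℝ (fun p : ℝ × ℝ => f p.1 p.2) (x, y) (0, 1)) y := by
  have h := (hf.differentiable (by simp) (x, y)).hasFDerivAt
  exact h.comp_hasDerivAt y ((hasDerivAt_const y x).prodMk (hasDerivAt_id y))

theorem pd1_eq_fderiv (hf : ContDiff ℝ (⊤ : ℕ∞) (fun p : ℝ × ℝ => f p.1 p.2)) (x y : ℝ) :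
    pd1 f x y = fderiv ℝ (fun p : ℝ × ℝ => f p.1 p.2) (x, y) (1, 0) :=
  (hasDerivAt_fst_of_contDiff hf x y).deriv

theorem pd2_eq_fderiv (hf : ContDiff ℝ (⊤ : ℕ∞) (fun p : ℝ × ℝ => f p.1 p.2)) (x y : ℝ) :
    pd2 f x y = fderiv ℝ (fun p : ℝ × ℝ => f p.1 p.2) (x, y) (0, 1) :=
  (hasDerivAt_snd_of_contDiff hf x y).deriv

theorem hasDerivAt_pd1 (hf : ContDiff ℝ (⊤ : ℕ∞) (fun p : ℝ × ℝ => f p.1 p.2)) (x y : ℝ) :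
    HasDerivAt (fun x' => f x' y) (pd1 f x y) x :=
  (hasDerivAt_fst_of_contDiff hf x y).differentiableAt.hasDerivAt

theorem hasDerivAt_pd2 (hf : ContDiff ℝ (⊤ : ℕ∞) (fun p : ℝ × ℝ => f p.1 p.2)) (x y : ℝ) :
    HasDerivAt (fun y' => f x y') (pd2 f x y) y :=
  (hasDerivAt_snd_of_contDiff hf x y).differentiableAt.hasDerivAt

theorem contDiff_pd1 (hf : ContDiff ℝ (⊤ : ℕ∞) (fun p : ℝ × ℝ => f p.1 p.2)) :
    ContDiff ℝ (⊤ : ℕ∞) (fun p : ℝ × ℝ => pd1 f p.1 p.2) := by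
  simp only [pd1_eq_fderiv hf]
  exact (hf.fderiv_right (m := (⊤ : ℕ∞)) (by simp)).clm_apply contDiff_const

theorem contDiff_pd2 (hf : ContDiff ℝ (⊤ : ℕ∞) (fun p : ℝ × ℝ => f p.1 p.2)) :
    ContDiff ℝ (⊤ : ℕ∞) (fun p : ℝ × ℝ => pd2 f p.1 p.2) := by
  simp only [pd2_eq_fderiv hf]
  exact (hf.fderiv_right (m := (⊤ : ℕ∞)) (by simp)).clm_apply contDiff_const

theorem pd1_pd2_comm (hf : ContDiff ℝ (⊤ : ℕ∞) (fun p : ℝ × ℝ => f p.1 p.2)) (x y : ℝ) :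
    pd1 (pd2 f) x y = pd2 (pd1 f) x y := by
  have hd : Differentiable ℝ (fderiv ℝ (fun p : ℝ × ℝ => f p.1 p.2)) :=
    (hf.fderiv_right (m := (⊤ : ℕ∞)) (by simp)).differentiable (by simp)
  have key : ∀ v w : ℝ × ℝ, ∀ p, fderiv ℝ
      (fun p => fderiv ℝ (fun p : ℝ × ℝ => f p.1 p.2) p v) p w =
      fderiv ℝ (fderiv ℝ (fun p : ℝ × ℝ => f p.1 p.2)) p w v := by
    intro v w p
    rw [fderiv_clm_apply (hd p) (differentiableAt_const v)]
    simp
  rw [pd1_eq_fderiv (contDiff_pd2 hf), pd2_eq_fderiv (contDiff_pd1 hf)]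
  simp only [pd1_eq_fderiv hf, pd2_eq_fderiv hf, key]
  have h2 : minSmoothness ℝ 2 ≤ ((⊤ : ℕ∞) : WithTop ℕ∞) := by
    simpa using WithTop.coe_le_coe.2 (le_top : (2 : ℕ∞) ≤ ⊤)
  exact (hf.contDiffAt.isSymmSndFDerivAt h2).eq _ _

/-- Hadamard's lemma in the second variable, with a Lipschitz estimate at the origin for the
quotient. -/
theorem exists_hadamard_quotient (hf : ContDiff ℝ (⊤ : ℕ∞) (fun p : ℝ × ℝ => f p.1 p.2)) :
    ∃ g : ℝ → ℝ → ℝ, Continuous (fun p : ℝ × ℝ => g p.1 p.2) ∧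
      (∀ x y, f x y = f x 0 + y * g x y) ∧ (∀ x, g x 0 = pd2 f x 0) ∧
      ∀ L : ℝ, ∃ M : ℝ, 0 ≤ M ∧ ∀ x y : ℝ, |x| ≤ L → |y| ≤ L →
        |g x y - g 0 0| ≤ M * (|x| + |y|) := by
  have hc := contDiff_pd2 hf
  have hcont : Continuous (fun p : ℝ × ℝ => pd2 f p.1 p.2) := hc.continuous
  have hline : ∀ x y : ℝ, Continuous fun t : ℝ => pd2 f x (t * y) := fun x y =>
    hcont.comp (by fun_prop : Continuous fun t : ℝ => (x, t * y))
  refine ⟨fun x y => ∫ t in (0:ℝ)..1, pd2 f x (t * y), ?_, ?_, ?_, ?_⟩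
  · refine intervalIntegral.continuous_parametric_intervalIntegral_of_continuous'
      (f := fun (p : ℝ × ℝ) (t : ℝ) => pd2 f p.1 (t * p.2)) ?_ 0 1
    exact hcont.comp (by fun_prop : Continuous fun q : (ℝ × ℝ) × ℝ => (q.1.1, q.2 * q.1.2))
  · intro x y
    have h : ∀ t ∈ uIcc (0:ℝ) 1, HasDerivAt (fun t => f x (t * y)) (y * pd2 f x (t * y)) t := by
      intro t _
      have h1 := (hasDerivAt_pd2 hf x (t * y)).comp t ((hasDerivAt_id t).mul_const y)
      exact h1.congr_deriv (by ring)
    have := intervalIntegral.integral_eq_sub_of_hasDerivAt h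
      ((continuous_const.mul (hline x y)).intervalIntegrable _ _)
    rw [intervalIntegral.integral_const_mul] at this
    simp only [one_mul, zero_mul] at this
    linarith
  · intro x; simp
  · intro L
    obtain ⟨K, hK⟩ := (hc.of_le (m := 1) (by simp)).locallyLipschitz.locallyLipschitzOn
      |>.exists_lipschitzOnWith_of_compact (isCompact_closedBall (0 : ℝ × ℝ) L)
    refine ⟨K, K.2, fun x y hx hy => ?_⟩
    have h0 : (0 : ℝ × ℝ) ∈ Metric.closedBall (0 : ℝ × ℝ) L :=
      Metric.mem_closedBall_self ((abs_nonneg x).trans hx)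
    rw [← intervalIntegral.integral_sub ((hline x y).intervalIntegrable _ _)
      ((hline 0 0).intervalIntegrable _ _)]
    have := intervalIntegral.norm_integral_le_of_norm_le_const (a := 0) (b := 1)
      (C := K * (|x| + |y|)) (f := fun t => pd2 f x (t * y) - pd2 f 0 (t * 0)) ?_
    · simpa using this
    · intro t ht
      rw [uIoc_of_le zero_le_one] at ht
      have hty : |t * y| ≤ |y| := by
        rw [abs_mul, abs_of_pos ht.1]
        exact mul_le_of_le_one_left (abs_nonneg _) ht.2
      have hm : (x, t * y) ∈ Metric.closedBall (0 : ℝ × ℝ) L := by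
        simp only [mem_closedBall_zero_iff, Prod.norm_def, Real.norm_eq_abs]
        exact max_le hx (hty.trans hy)
      have h1 := hK.dist_le_mul _ hm _ h0
      simp only [Real.dist_eq, dist_zero_right, Prod.norm_def, Real.norm_eq_abs, Prod.fst_zero, Prod.snd_zero] at h1
      simp only [mul_zero, Real.norm_eq_abs]
      refine h1.trans (mul_le_mul_of_nonneg_left (max_le ?_ ?_) K.2)
      · linarith [abs_nonneg y]
      · linarith [abs_nonneg x]

end PartialDerivatives

/-- A continuous function, nonvanishing on a segment and positive at one of its points, is bounded
below and above by positive constants near the segment. -/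
theorem exists_pos_bounds_near_segment {g : ℝ → ℝ → ℝ}
    (hg : Continuous fun p : ℝ × ℝ => g p.1 p.2) {R U : ℝ} (hR : 0 < R) (hU : 0 < U)
    (h0 : 0 < g 0 0) (hne : ∀ u, 0 < |u| → |u| ≤ U → g 0 u ≠ 0) :
    ∃ m M δ : ℝ, 0 < m ∧ 0 < M ∧ 0 < δ ∧ δ ≤ R ∧
      ∀ x ∈ Icc 0 δ, ∀ u ∈ Icc (-U) U, m ≤ g x u ∧ g x u ≤ M := by
  have hg0 : Continuous fun u => g 0 u := hg.comp (by fun_prop : Continuous fun u : ℝ => ((0:ℝ), u))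
  have hU0 : (0:ℝ) ∈ Icc (-U) U := ⟨by linarith, hU.le⟩
  have hpos : ∀ u ∈ Icc (-U) U, 0 < g 0 u := by
    intro u hu
    by_contra! hle
    obtain ⟨v, hv, hv0⟩ := (isPreconnected_Icc (a := -U) (b := U)).intermediate_value hu hU0
      hg0.continuousOn ⟨hle, h0.le⟩
    have hv0 : g 0 v = 0 := hv0
    by_cases hvz : v = 0
    · subst hvz; linarith
    · exact hne v (abs_pos.2 hvz) (abs_le.2 hv) hv0
  obtain ⟨u₀, hu₀, hmin⟩ := isCompact_Icc.exists_isMinOn ⟨0, hU0⟩ hg0.continuousOn (s := Icc (-U) U)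
  have hm := hpos u₀ hu₀
  obtain ⟨V, W, hV, _, hV0, hW, hVW⟩ := generalized_tube_lemma (isCompact_singleton (x := (0:ℝ)))
    (isCompact_Icc (a := -U) (b := U)) (isOpen_lt continuous_const hg) (n := {p : ℝ × ℝ | g 0 u₀ / 2 < g p.1 p.2}) (by
      rintro ⟨x, u⟩ ⟨hx, hu⟩
      obtain rfl : x = 0 := hx
      have : g 0 u₀ ≤ g 0 u := hmin hu
      show g 0 u₀ / 2 < g 0 u
      linarith)
  obtain ⟨ε, hε, hεV⟩ := Metric.isOpen_iff.1 hV 0 (hV0 rfl)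
  obtain ⟨B, hB⟩ := ((isCompact_Icc (a := (0:ℝ)) (b := R)).prod
    (isCompact_Icc (a := -U) (b := U))).bddAbove_image hg.continuousOn
  have hδ : 0 < min R (ε / 2) := lt_min hR (by linarith)
  refine ⟨g 0 u₀ / 2, max B 1, min R (ε / 2), by linarith, by positivity, hδ, min_le_left _ _, ?_⟩
  rintro x ⟨hx0, hx⟩ u hu
  refine ⟨le_of_lt (hVW (show (x, u) ∈ V ×ˢ W from ⟨hεV ?_, hW hu⟩)), ?_⟩
  · rw [mem_ball_zero_iff, Real.norm_eq_abs, abs_of_nonneg hx0]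
    linarith [hx.trans (min_le_right _ _)]
  · exact (hB ⟨(x, u), ⟨⟨hx0, hx.trans (min_le_left _ _)⟩, hu⟩, rfl⟩).trans (le_max_left _ _)

section Growth

/-- A continuous function cannot reach a level that it is a priori known not to attain as long as
it does not exceed it. -/
theorem lt_of_forall_le_imp_lt {f : ℝ → ℝ} {a b L : ℝ} (hf : ContinuousOn f (Icc a b))
    (ha : f a < L) (h : ∀ x ∈ Icc a b, (∀ y ∈ Icc a x, f y ≤ L) → f x < L) :
    ∀ x ∈ Icc a b, f x < L := by
  by_contra! hex
  have hcl : IsClosed {x ∈ Icc a b | L ≤ f x} :=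
    hf.preimage_isClosed_of_isClosed isClosed_Icc isClosed_Ici
  have hbd : BddBelow {x ∈ Icc a b | L ≤ f x} := ⟨a, fun x hx => hx.1.1⟩
  obtain ⟨hc, hLc⟩ := hcl.csInf_mem hex hbd
  have hmin : ∀ y ∈ Icc a b, L ≤ f y → sInf {x ∈ Icc a b | L ≤ f x} ≤ y := fun y hy hLy =>
    csInf_le hbd ⟨hy, hLy⟩
  generalize sInf {x ∈ Icc a b | L ≤ f x} = c at hc hLc hmin
  obtain ⟨z, hz, hzL⟩ := intermediate_value_Icc hc.1
    (hf.mono (Icc_subset_Icc_right hc.2)) ⟨ha.le, hLc⟩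
  have hzc : z = c := le_antisymm hz.2 (hmin z ⟨hz.1, hz.2.trans hc.2⟩ hzL.ge)
  subst hzc
  refine absurd (h z hc fun y hy => ?_) (not_lt.2 hLc)
  rcases hy.2.eq_or_lt with rfl | hlt
  · exact hzL.le
  · by_contra! hLy
    exact absurd (hmin y ⟨hy.1, hy.2.trans hc.2⟩ hLy.le) (not_le.2 hlt)

/-- Mean value inequalities for a function with pointwise derivative on an interval. -/
theorem sub_le_mul_sub_of_hasDerivAt {f f' : ℝ → ℝ} {a b C : ℝ} (hab : a ≤ b)
    (hd : ∀ x ∈ Icc a b, HasDerivAt f (f' x) x) (hC : ∀ x ∈ Ioo a b, f' x ≤ C) :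
    f b - f a ≤ C * (b - a) := by
  refine (convex_Icc a b).image_sub_le_mul_sub_of_deriv_le (HasDerivAt.continuousOn hd) ?_ ?_
    a (left_mem_Icc.2 hab) b (right_mem_Icc.2 hab) hab
  · intro x hx
    exact (hd x (interior_subset hx)).differentiableAt.differentiableWithinAt
  · intro x hx
    rw [(hd x (interior_subset hx)).deriv]
    exact hC x (by rwa [interior_Icc] at hx)

theorem mul_sub_le_sub_of_hasDerivAt {f f' : ℝ → ℝ} {a b C : ℝ} (hab : a ≤ b)
    (hd : ∀ x ∈ Icc a b, HasDerivAt f (f' x) x) (hC : ∀ x ∈ Ioo a b, C ≤ f' x) :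
    C * (b - a) ≤ f b - f a := by
  have := sub_le_mul_sub_of_hasDerivAt (f := fun x => -f x) (f' := fun x => -f' x) (C := -C) hab
    (fun x hx => (hd x hx).neg) (fun x hx => neg_le_neg (hC x hx))
  linarith

theorem le_of_hasDerivAt_nonneg {f f' : ℝ → ℝ} {a b : ℝ} (hab : a ≤ b)
    (hd : ∀ x ∈ Icc a b, HasDerivAt f (f' x) x) (h0 : ∀ x ∈ Ioo a b, 0 ≤ f' x) :
    f a ≤ f b := by
  have := mul_sub_le_sub_of_hasDerivAt hab hd h0
  linarith

/-- Bounds to the left of the origin for a nonnegative function whose slope is comparable with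
`√σ + |u|`. -/
theorem left_bounds_of_slope {k K : ℝ} (hk : 0 < k) (hK : 0 < K) :
    ∃ C₁ C₂ : ℝ, 0 < C₁ ∧ 0 < C₂ ∧ ∀ (σ σ' : ℝ → ℝ) (x : ℝ), x ≤ 0 →
      (∀ u ∈ Icc x 0, HasDerivAt σ (σ' u) u) → (∀ u ∈ Icc x 0, 0 ≤ σ u) →
      (∀ u ∈ Icc x 0, k * √(σ u) ≤ σ' u ∧ k * -u ≤ σ' u ∧ σ' u ≤ K * (√(σ u) + -u)) →
      σ 0 + C₁ * √(σ 0) * x ≤ σ x ∧ σ x ≤ σ 0 + C₂ * √(σ 0) * x := by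
  obtain ⟨B, hB, hBk⟩ : ∃ B : ℝ, 0 < B ∧ 2 ≤ k * B ^ 2 := by
    refine ⟨√(2 / k), by positivity, ?_⟩
    rw [Real.sq_sqrt (by positivity)]
    field_simp
    rfl
  obtain ⟨A, hA, hAdef⟩ : ∃ A : ℝ, 0 < A ∧ A = K * (1 + B) := ⟨_, by positivity, rfl⟩
  obtain ⟨ε, hε, hεA⟩ : ∃ ε : ℝ, 0 < ε ∧ A * ε ≤ 3 / 4 := by
    refine ⟨3 / (4 * A), by positivity, le_of_eq ?_⟩
    field_simp
  refine ⟨A, min (k / 2) (k * ε), hA, by positivity, ?_⟩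
  intro σ σ' x hx hd hpos hb
  have hs0 : 0 ≤ √(σ 0) := Real.sqrt_nonneg _
  have hsq : √(σ 0) ^ 2 = σ 0 := Real.sq_sqrt (hpos 0 ⟨hx, le_rfl⟩)
  have hsub : ∀ u ∈ Icc x 0, ∀ v ∈ Icc u 0, v ∈ Icc x 0 := fun u hu v hv =>
    ⟨hu.1.trans hv.1, hv.2⟩
  have hle : ∀ u ∈ Icc x 0, σ u ≤ σ 0 := fun u hu =>
    le_of_hasDerivAt_nonneg hu.2 (fun v hv => hd v (hsub u hu v hv)) fun v hv =>
      le_trans (mul_nonneg hk.le (Real.sqrt_nonneg _)) (hb v (hsub u hu v ⟨hv.1.le, hv.2.le⟩)).1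
  have hxB : -x ≤ B * √(σ 0) := by
    have h1 : σ x + k / 2 * x ^ 2 ≤ σ 0 := by
      have := le_of_hasDerivAt_nonneg (f := fun u => σ u + k / 2 * u ^ 2)
        (f' := fun u => σ' u + k * u) hx (fun u hu => by
          have := (hd u hu).add (((hasDerivAt_id u).pow 2).const_mul (k / 2))
          refine this.congr_deriv ?_
          simp; ring) (fun u hu => by
          have := (hb u ⟨hu.1.le, hu.2.le⟩).2.1
          linarith)
      simpa using this
    have h2 := hpos x ⟨le_rfl, hx⟩
    by_contra! hlt
    have h3 : (B * √(σ 0)) ^ 2 < (-x) ^ 2 := pow_lt_pow_left₀ hlt (by positivity) two_ne_zero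
    have h4 : k * (B * √(σ 0)) ^ 2 < k * (-x) ^ 2 := mul_lt_mul_of_pos_left h3 hk
    have h5 : 2 * √(σ 0) ^ 2 ≤ k * B ^ 2 * √(σ 0) ^ 2 :=
      mul_le_mul_of_nonneg_right hBk (sq_nonneg _)
    nlinarith
  have hup : ∀ u ∈ Icc x 0, σ' u ≤ A * √(σ 0) := by
    intro u hu
    have h1 := Real.sqrt_le_sqrt (hle u hu)
    have h2 : √(σ u) + -u ≤ √(σ 0) + B * √(σ 0) := by linarith [hu.1]
    have h3 := (hb u hu).2.2.trans (mul_le_mul_of_nonneg_left h2 hK.le)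
    rw [hAdef]; linarith
  have hlow : ∀ u ∈ Icc x 0, σ 0 + A * √(σ 0) * u ≤ σ u := by
    intro u hu
    have := sub_le_mul_sub_of_hasDerivAt hu.2 (fun v hv => hd v (hsub u hu v hv))
      (fun v hv => hup v (hsub u hu v ⟨hv.1.le, hv.2.le⟩))
    linarith
  refine ⟨hlow x ⟨le_rfl, hx⟩, ?_⟩
  have hdown : ∀ u ∈ Icc x 0, min (k / 2) (k * ε) * √(σ 0) ≤ σ' u := by
    intro u hu
    rcases le_total (-u) (ε * √(σ 0)) with h | h
    · have h1 : (√(σ 0) / 2) ^ 2 ≤ σ u := by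
        have h2 := hlow u hu
        have h3 : A * √(σ 0) * -u ≤ A * √(σ 0) * (ε * √(σ 0)) :=
          mul_le_mul_of_nonneg_left h (by positivity)
        have h4 : A * ε * √(σ 0) ^ 2 ≤ 3 / 4 * √(σ 0) ^ 2 :=
          mul_le_mul_of_nonneg_right hεA (sq_nonneg _)
        nlinarith
      have h2 := Real.le_sqrt_of_sq_le h1
      calc min (k / 2) (k * ε) * √(σ 0) ≤ k / 2 * √(σ 0) :=
            mul_le_mul_of_nonneg_right (min_le_left _ _) hs0
        _ = k * (√(σ 0) / 2) := by ring
        _ ≤ k * √(σ u) := mul_le_mul_of_nonneg_left h2 hk.le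
        _ ≤ σ' u := (hb u hu).1
    · calc min (k / 2) (k * ε) * √(σ 0) ≤ k * ε * √(σ 0) :=
            mul_le_mul_of_nonneg_right (min_le_right _ _) hs0
        _ = k * (ε * √(σ 0)) := by ring
        _ ≤ k * -u := mul_le_mul_of_nonneg_left h hk.le
        _ ≤ σ' u := (hb u hu).2.1
  have := mul_sub_le_sub_of_hasDerivAt hx hd (fun u hu => hdown u ⟨hu.1.le, hu.2.le⟩)
  linarith

/-- Integrated form of `σ' ≤ K √σ`. -/
theorem le_of_slope_le_sqrt {K : ℝ} (hK : 0 < K) {σ σ' : ℝ → ℝ} {x : ℝ} (hx : 0 ≤ x)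
    (hd : ∀ u ∈ Icc 0 x, HasDerivAt σ (σ' u) u) (hpos : ∀ u ∈ Icc 0 x, 0 ≤ σ u)
    (hb : ∀ u ∈ Icc 0 x, 0 ≤ σ' u ∧ σ' u ≤ K * √(σ u)) :
    σ x ≤ σ 0 + K * x * (√(σ 0) + K * x) := by
  have hsq0 : √(σ 0) ^ 2 = σ 0 := Real.sq_sqrt (hpos 0 ⟨le_rfl, hx⟩)
  have hsqx : √(σ x) ^ 2 = σ x := Real.sq_sqrt (hpos x ⟨hx, le_rfl⟩)
  have hle : ∀ u ∈ Icc 0 x, σ u ≤ σ x := fun u hu =>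
    le_of_hasDerivAt_nonneg hu.2 (fun v hv => hd v ⟨hu.1.trans hv.1, hv.2⟩) fun v hv =>
      (hb v ⟨hu.1.trans hv.1.le, hv.2.le⟩).1
  have h1 : σ x - σ 0 ≤ K * √(σ x) * (x - 0) := sub_le_mul_sub_of_hasDerivAt hx hd fun u hu =>
    have hu' : u ∈ Icc 0 x := ⟨hu.1.le, hu.2.le⟩
    (hb u hu').2.trans (mul_le_mul_of_nonneg_left (Real.sqrt_le_sqrt (hle u hu')) hK.le)
  have hKx : 0 ≤ K * x := by positivity
  have h2 : √(σ x) ≤ √(σ 0) + K * x := by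
    by_contra! hlt
    have h3 : √(σ 0) * √(σ 0) ≤ √(σ 0) * √(σ x) :=
      mul_le_mul_of_nonneg_left (by linarith) (Real.sqrt_nonneg _)
    have h4 : 0 < √(σ x) := by linarith [Real.sqrt_nonneg (σ 0)]
    have h5 : (√(σ 0) + K * x) * √(σ x) < √(σ x) * √(σ x) := mul_lt_mul_of_pos_right hlt h4
    nlinarith
  have h3 := mul_le_mul_of_nonneg_left h2 hKx
  nlinarith

/-- Integrated form of `σ' ≤ (p / u + N) σ`. -/
theorem le_rpow_of_slope_le {p N : ℝ} {σ σ' : ℝ → ℝ} {s x : ℝ} (hs : 0 < s) (hsx : s ≤ x)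
    (hd : ∀ u ∈ Icc s x, HasDerivAt σ (σ' u) u)
    (hb : ∀ u ∈ Icc s x, u * σ' u ≤ (p + N * u) * σ u) :
    σ x ≤ σ s * s ^ (-p) * x ^ p * Real.exp (N * (x - s)) := by
  have hx : 0 < x := hs.trans_le hsx
  have h := sub_le_mul_sub_of_hasDerivAt (C := 0)
    (f := fun u => σ u * (u ^ (-p) * Real.exp (-(N * u))))
    (f' := fun u => σ' u * (u ^ (-p) * Real.exp (-(N * u))) + σ u *
      ((-p * u ^ (-p - 1)) * Real.exp (-(N * u)) + u ^ (-p) * (Real.exp (-(N * u)) * (-N))))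
    hsx (fun u hu => by
      have hu0 : 0 < u := hs.trans_le hu.1
      have h1 := Real.hasDerivAt_rpow_const (x := u) (p := -p) (Or.inl hu0.ne')
      have h2 : HasDerivAt (fun u : ℝ => Real.exp (-(N * u))) (Real.exp (-(N * u)) * (-N)) u := by
        have := ((hasDerivAt_id u).const_mul N).neg.exp
        simpa using this
      exact (hd u hu).mul (h1.mul h2))
    (fun u hu => by
      have hu' : u ∈ Icc s x := ⟨hu.1.le, hu.2.le⟩
      have hu0 : 0 < u := hs.trans hu.1
      have h1 : u ^ (-p) = u ^ (-p - 1) * u := by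
        rw [← Real.rpow_add_one hu0.ne']; ring_nf
      rw [h1]
      have h2 : 0 < u ^ (-p - 1) * Real.exp (-(N * u)) := by positivity
      have h3 := mul_le_mul_of_nonneg_left (hb u hu') h2.le
      nlinarith)
  have h2 : σ x * (x ^ (-p) * Real.exp (-(N * x))) ≤ σ s * (s ^ (-p) * Real.exp (-(N * s))) := by
    linarith
  have h3 := mul_le_mul_of_nonneg_right h2 (by positivity : 0 ≤ x ^ p * Real.exp (N * x))
  have h4 : x ^ (-p) * x ^ p = 1 := by rw [← Real.rpow_add hx]; simp
  have h5 : Real.exp (-(N * x)) * Real.exp (N * x) = 1 := by rw [← Real.exp_add]; simp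
  have h6 : Real.exp (N * (x - s)) = Real.exp (-(N * s)) * Real.exp (N * x) := by
    rw [← Real.exp_add]; ring_nf
  calc σ x = σ x * (x ^ (-p) * x ^ p) * (Real.exp (-(N * x)) * Real.exp (N * x)) := by
        rw [h4, h5]; ring
    _ = σ x * (x ^ (-p) * Real.exp (-(N * x))) * (x ^ p * Real.exp (N * x)) := by ring
    _ ≤ _ := h3
    _ = _ := by rw [h6]; ring

/-- Bounds to the right of the origin. -/
theorem right_bounds_of_slope {K M p U : ℝ} (hK : 0 < K) (hM : 0 ≤ M) (hp1 : p ≤ 1)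
    (hU : 0 < U) :
    ∃ C : ℝ, 0 < C ∧ ∀ (σ σ' : ℝ → ℝ) (x : ℝ), 0 ≤ x → x ≤ U →
      (∀ u ∈ Icc 0 x, HasDerivAt σ (σ' u) u) → (∀ u ∈ Icc 0 x, 0 ≤ σ u) →
      (∀ u ∈ Icc 0 x, 0 ≤ σ' u ∧ σ' u ≤ K * √(σ u) ∧ u * σ' u ≤ (p + M * (u + σ u)) * σ u) →
      σ x ≤ σ 0 + C * min (√(σ 0) * x) (σ 0 ^ (1 - p / 2) * x ^ p) := by
  set A : ℝ := (1 + K * (1 + K)) with hA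
  have hA0 : 0 < A := by positivity
  set N : ℝ := M * (1 + A * U) with hN
  have hN0 : 0 ≤ N := by positivity
  set E : ℝ := A * Real.exp (N * U) with hE
  have hE0 : 0 < E := by positivity
  refine ⟨max (K * (1 + K)) E, lt_max_of_lt_right hE0, ?_⟩
  intro σ σ' x hx hxU hd hpos hb
  have hs0 : 0 ≤ √(σ 0) := Real.sqrt_nonneg _
  have hsq0 : √(σ 0) ^ 2 = σ 0 := Real.sq_sqrt (hpos 0 ⟨le_rfl, hx⟩)
  have hquad : ∀ u ∈ Icc 0 x, σ u ≤ σ 0 + K * u * (√(σ 0) + K * u) := fun u hu =>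
    le_of_slope_le_sqrt hK hu.1 (fun v hv => hd v ⟨hv.1, hv.2.trans hu.2⟩)
      (fun v hv => hpos v ⟨hv.1, hv.2.trans hu.2⟩)
      (fun v hv => ⟨(hb v ⟨hv.1, hv.2.trans hu.2⟩).1, (hb v ⟨hv.1, hv.2.trans hu.2⟩).2.1⟩)
  have hfar : ∀ u ∈ Icc 0 x, √(σ 0) ≤ u → σ u ≤ A * u ^ 2 := by
    intro u hu hsu
    have h1 : √(σ 0) ^ 2 ≤ u ^ 2 := pow_le_pow_left₀ hs0 hsu 2
    have h2 : K * u * (√(σ 0) + K * u) ≤ K * u * (u + K * u) :=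
      mul_le_mul_of_nonneg_left (by linarith) (mul_nonneg hK.le hu.1)
    have h3 := hquad u hu
    rw [hA]; nlinarith
  have hgrow : ∀ s, 0 < s → √(σ 0) ≤ s → s ≤ x → σ x ≤ E * s ^ (2 - p) * x ^ p := by
    intro s hs hss hsx
    have h1 := le_rpow_of_slope_le (p := p) (N := N) hs hsx
      (fun u hu => hd u ⟨hs.le.trans hu.1, hu.2⟩) (fun u hu => by
        have hu' : u ∈ Icc 0 x := ⟨hs.le.trans hu.1, hu.2⟩
        refine (hb u hu').2.2.trans (mul_le_mul_of_nonneg_right ?_ (hpos u hu'))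
        have h2 := hfar u hu' (hss.trans hu.1)
        have h3 : A * u ^ 2 ≤ A * U * u := by
          have : u * u ≤ U * u := mul_le_mul_of_nonneg_right (hu.2.trans hxU) hu'.1
          nlinarith
        have h4 : M * (u + σ u) ≤ M * (u + A * U * u) :=
          mul_le_mul_of_nonneg_left (by linarith) hM
        rw [hN]; linarith)
    have h2 := hfar s ⟨hs.le, hsx⟩ hss
    have h3 : s ^ (2 - p) = s ^ 2 * s ^ (-p) := by
      rw [sub_eq_add_neg, Real.rpow_add hs]; norm_num
    have h4 : Real.exp (N * (x - s)) ≤ Real.exp (N * U) :=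
      Real.exp_le_exp.2 (mul_le_mul_of_nonneg_left (by linarith) hN0)
    calc σ x ≤ _ := h1
      _ ≤ (A * s ^ 2) * s ^ (-p) * x ^ p * Real.exp (N * U) := by
        gcongr
      _ = _ := by rw [h3, hE]; ring
  rcases (hpos 0 ⟨le_rfl, hx⟩).eq_or_lt with h0 | h0
  · have hz : σ x ≤ 0 := by
      rcases hx.eq_or_lt with rfl | hx0
      · exact h0.ge
      · have hlim : Filter.Tendsto (fun s : ℝ => E * s ^ (2 - p) * x ^ p)
            (nhdsWithin 0 (Ioi 0)) (nhds 0) := by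
          have h1 : ContinuousAt (fun s : ℝ => E * s ^ (2 - p) * x ^ p) 0 :=
            ((Real.continuousAt_rpow_const 0 (2 - p) (Or.inr (by linarith))).const_mul
              E).mul_const (x ^ p)
          have h2 := h1.tendsto
          simp only [Real.zero_rpow (by linarith : 2 - p ≠ 0), mul_zero, zero_mul] at h2
          exact h2.mono_left nhdsWithin_le_nhds
        refine ge_of_tendsto hlim ?_
        filter_upwards [Ioc_mem_nhdsGT hx0] with s hs
        exact hgrow s hs.1 (by rw [← h0]; simpa using hs.1.le) hs.2
    rw [← h0, Real.zero_rpow (by linarith)]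
    simpa using hz
  · have hs : 0 < √(σ 0) := Real.sqrt_pos.2 h0
    have hr1 : σ 0 ^ (1 - p / 2) = √(σ 0) ^ (2 - p) := by
      rw [Real.sqrt_eq_rpow, ← Real.rpow_mul h0.le]; ring_nf
    have hr2 : √(σ 0) * √(σ 0) ^ (1 - p) = √(σ 0) ^ (2 - p) := by
      rw [mul_comm, ← Real.rpow_add_one hs.ne']; ring_nf
    rw [hr1]
    rcases le_total x √(σ 0) with h | h
    · have hm : √(σ 0) * x ≤ √(σ 0) ^ (2 - p) * x ^ p := by
        rcases hx.eq_or_lt with rfl | hx0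
        · rw [mul_zero]; positivity
        · have h1 : x = x ^ (1 - p) * x ^ p := by rw [← Real.rpow_add hx0]; simp
          have h2 : x ^ (1 - p) ≤ √(σ 0) ^ (1 - p) :=
            Real.rpow_le_rpow hx h (by linarith)
          calc √(σ 0) * x = √(σ 0) * (x ^ (1 - p) * x ^ p) := by rw [← h1]
            _ ≤ √(σ 0) * (√(σ 0) ^ (1 - p) * x ^ p) := by gcongr
            _ = _ := by rw [← mul_assoc, hr2]
      rw [min_eq_left hm]
      have h1 := hquad x ⟨hx, le_rfl⟩
      have h2 : K * x * (√(σ 0) + K * x) ≤ K * x * (√(σ 0) + K * √(σ 0)) := by gcongr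
      have h3 : K * (1 + K) * (√(σ 0) * x) ≤ max (K * (1 + K)) E * (√(σ 0) * x) := by
        gcongr; exact le_max_left _ _
      linarith
    · have hx0 : 0 < x := hs.trans_le h
      have hm : √(σ 0) ^ (2 - p) * x ^ p ≤ √(σ 0) * x := by
        have h1 : x = x ^ (1 - p) * x ^ p := by rw [← Real.rpow_add hx0]; simp
        have h2 : √(σ 0) ^ (1 - p) ≤ x ^ (1 - p) :=
          Real.rpow_le_rpow hs0 h (by linarith)
        calc √(σ 0) ^ (2 - p) * x ^ p = √(σ 0) * (√(σ 0) ^ (1 - p) * x ^ p) := by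
              rw [← mul_assoc, hr2]
          _ ≤ √(σ 0) * (x ^ (1 - p) * x ^ p) := by gcongr
          _ = _ := by rw [← h1]
      rw [min_eq_right hm]
      have h1 := hgrow _ hs le_rfl h
      have h3 : E * (√(σ 0) ^ (2 - p) * x ^ p) ≤
          max (K * (1 + K)) E * (√(σ 0) ^ (2 - p) * x ^ p) := by
        gcongr; exact le_max_right _ _
      linarith

end Growth

section FluxBounds

/-- Bounds for the root `(√((ua)² + 4Bρc) - ua) / (2B)` of a quadratic polynomial whose coefficients
`a`, `B`, `c` are positive, bounded, and bounded away from zero. -/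
theorem quadratic_root_bounds {a₀ a₁ b₀ b₁ c₀ c₁ p M : ℝ} (ha₀ : 0 < a₀) (ha₁ : 0 < a₁)
    (hb₀ : 0 < b₀) (hb₁ : 0 < b₁) (hc₀ : 0 < c₀) (hc₁ : 0 < c₁) (hM : 0 ≤ M) :
    ∃ k K M' : ℝ, 0 < k ∧ 0 < K ∧ 0 ≤ M' ∧ ∀ a B c ρ u F : ℝ, a₀ ≤ a → a ≤ a₁ → b₀ ≤ B → B ≤ b₁ →
      c₀ ≤ c → c ≤ c₁ → c ≤ p * a + M * (ρ + |u|) → 0 ≤ ρ →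
      F = (√((u * a) ^ 2 + 4 * B * (ρ * c)) - u * a) / (2 * B) →
      0 ≤ F ∧ (u ≤ 0 → k * √ρ ≤ F ∧ k * -u ≤ F ∧ F ≤ K * (√ρ + -u)) ∧
        (0 ≤ u → F ≤ K * √ρ ∧ u * F ≤ (p + M' * (u + ρ)) * ρ) := by
  refine ⟨min (√(4 * b₀ * c₀) / (2 * b₁)) (a₀ / b₁), a₁ / b₀ + √(4 * b₁ * c₁) / (2 * b₀), M / a₀,
    by positivity, by positivity, by positivity, ?_⟩
  intro a B c ρ u F ha ha' hB hB' hc hc' hca hρ hF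
  have ha0 : 0 < a := ha₀.trans_le ha
  have hB0 : 0 < B := hb₀.trans_le hB
  have hc0 : 0 < c := hc₀.trans_le hc
  set S := √((u * a) ^ 2 + 4 * B * (ρ * c)) with hS
  have hS0 : 0 ≤ S := Real.sqrt_nonneg _
  have hS2 : S ^ 2 = (u * a) ^ 2 + 4 * B * (ρ * c) := Real.sq_sqrt (by positivity)
  have hSabs : |u| * a ≤ S := by
    refine Real.le_sqrt_of_sq_le ?_
    rw [mul_pow, sq_abs, mul_pow]
    have : 0 ≤ 4 * B * (ρ * c) := by positivity
    linarith
  have hSlow : √(4 * b₀ * c₀) * √ρ ≤ S := by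
    rw [← Real.sqrt_mul (by positivity)]
    refine Real.sqrt_le_sqrt ?_
    have h1 : b₀ * c₀ ≤ B * c := by gcongr
    have h2 := mul_le_mul_of_nonneg_right h1 hρ
    nlinarith [sq_nonneg (u * a)]
  have hSup : S ≤ |u| * a + √(4 * b₁ * c₁) * √ρ := by
    rw [← Real.sqrt_mul (by positivity)]
    refine Real.sqrt_le_iff.2 ⟨by positivity, ?_⟩
    have h1 : B * c ≤ b₁ * c₁ := by gcongr
    have h2 := mul_le_mul_of_nonneg_right h1 hρ
    have h3 : √(4 * b₁ * c₁ * ρ) ^ 2 = 4 * b₁ * c₁ * ρ := Real.sq_sqrt (by positivity)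
    have h4 : 0 ≤ |u| * a * √(4 * b₁ * c₁ * ρ) := by positivity
    have h5 : (|u| * a) ^ 2 = (u * a) ^ 2 := by rw [mul_pow, sq_abs, mul_pow]
    nlinarith
  have hFS : F * (2 * B) = S - u * a := by rw [hF]; field_simp
  have hua : u * a ≤ |u| * a := mul_le_mul_of_nonneg_right (le_abs_self u) ha0.le
  have hF0 : 0 ≤ F := by rw [hF]; exact div_nonneg (by linarith) (by linarith)
  have hFup : F * (2 * B) ≤ F * (2 * b₁) := by gcongr
  have hFlow : F * (2 * b₀) ≤ F * (2 * B) := by gcongr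
  refine ⟨hF0, fun hu => ⟨?_, ?_, ?_⟩, fun hu => ⟨?_, ?_⟩⟩
  · have h1 : √(4 * b₀ * c₀) / (2 * b₁) * √ρ ≤ F := by
      rw [div_mul_eq_mul_div, div_le_iff₀ (by positivity)]
      have : u * a ≤ 0 := mul_nonpos_of_nonpos_of_nonneg hu ha0.le
      linarith
    exact (mul_le_mul_of_nonneg_right (min_le_left _ _) (Real.sqrt_nonneg _)).trans h1
  · have h1 : a₀ / b₁ * -u ≤ F := by
      rw [div_mul_eq_mul_div, div_le_iff₀ hb₁]
      rw [abs_of_nonpos hu] at hSabs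
      have : a₀ * -u ≤ a * -u := mul_le_mul_of_nonneg_right ha (by linarith)
      linarith
    exact (mul_le_mul_of_nonneg_right (min_le_right _ _) (by linarith)).trans h1
  · rw [abs_of_nonpos hu] at hSup
    have h1 : F ≤ a₁ / b₀ * -u + √(4 * b₁ * c₁) / (2 * b₀) * √ρ := by
      have h2 : a * -u ≤ a₁ * -u := mul_le_mul_of_nonneg_right ha' (by linarith)
      have h3 : a₁ / b₀ * -u + √(4 * b₁ * c₁) / (2 * b₀) * √ρ =
        (2 * (a₁ * -u) + √(4 * b₁ * c₁) * √ρ) / (2 * b₀) := by field_simp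
      rw [h3, le_div_iff₀ (by positivity)]
      linarith
    have h2 : 0 ≤ a₁ / b₀ * √ρ := by positivity
    have h3 : 0 ≤ √(4 * b₁ * c₁) / (2 * b₀) * -u := mul_nonneg (by positivity) (by linarith)
    linarith
  · rw [abs_of_nonneg hu] at hSup
    have h1 : F ≤ √(4 * b₁ * c₁) / (2 * b₀) * √ρ := by
      rw [div_mul_eq_mul_div, le_div_iff₀ (by positivity)]
      linarith
    have h2 : 0 ≤ a₁ / b₀ * √ρ := by positivity
    linarith
  · have hua0 : 0 ≤ u * a := by positivity
    have h1 : u * F * a ≤ ρ * c := by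
      have h2 : F * (2 * B) * (2 * (u * a)) ≤ 4 * B * (ρ * c) := by
        rw [abs_of_nonneg hu] at hSabs
        rw [hFS]
        nlinarith
      have h3 : 4 * B * (u * F * a) ≤ 4 * B * (ρ * c) := by linarith
      exact le_of_mul_le_mul_left h3 (by positivity)
    rw [abs_of_nonneg hu] at hca
    have h4 : M * (ρ + u) ≤ M / a₀ * (u + ρ) * a := by
      have h5 : M * (ρ + u) = M / a₀ * (u + ρ) * a₀ := by field_simp; ring
      rw [h5]; gcongr
    have h6 : c ≤ (p + M / a₀ * (u + ρ)) * a := by linarith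
    have h7 := mul_le_mul_of_nonneg_left h6 hρ
    have h8 : u * F * a ≤ (p + M / a₀ * (u + ρ)) * ρ * a := by linarith
    exact le_of_mul_le_mul_right h8 ha0

/-- The derivative of a function vanishing on a nondegenerate segment vanishes there. -/
theorem HasDerivAt.eq_zero_of_eqOn_Icc {f : ℝ → ℝ} {f' a b x : ℝ} (hab : a < b)
    (hx : x ∈ Icc a b) (hf : HasDerivAt f f' x) (h0 : ∀ y ∈ Icc a b, f y = 0) : f' = 0 := by
  have h1 : HasDerivWithinAt f 0 (Icc a b) x :=
    (hasDerivWithinAt_const x (Icc a b) (0 : ℝ)).congr h0 (h0 x hx)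
  exact (uniqueDiffOn_Icc hab x hx).eq_deriv _ hf.hasDerivWithinAt h1

/-- Slope bounds for the characteristic field near `ρ = 0`. -/
theorem charRHS_bounds {ρstar ustar : ℝ} (hρs : 0 < ρstar) (hus : 0 < ustar)
    {Ψ Φ : ℝ → ℝ → ℝ}
    (hΨ : ContDiff ℝ (⊤ : ℕ∞) (fun p : ℝ × ℝ => Ψ p.1 p.2))
    (hΦ : ContDiff ℝ (⊤ : ℕ∞) (fun p : ℝ × ℝ => Φ p.1 p.2))
    (hΨodd : ∀ ρ ∈ Icc (0:ℝ) ρstar, ∀ u ∈ Icc (-ustar) ustar, Ψ ρ (-u) = -Ψ ρ u)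
    (hΦeven : ∀ ρ ∈ Icc (0:ℝ) ρstar, ∀ u ∈ Icc (-ustar) ustar, Φ ρ (-u) = Φ ρ u)
    (hΨ0 : ∀ u ∈ Icc (-ustar) ustar, Ψ 0 u = 0)
    (hΨρu00 : pd2 (pd1 Ψ) 0 0 = 1)
    (hΦρ00 : pd1 Φ 0 0 = 1)
    {γ : ℝ} (hγdef : γ = pd2 (pd2 Φ) 0 0 / 2) (hγ : 1 < γ)
    (hnondeg : ∀ u : ℝ, 0 < |u| → |u| ≤ ustar →
        pd2 Φ 0 u - pd1 Ψ 0 u ≠ 0 ∧ pd1 Φ 0 u ≠ 0 ∧ pd2 (pd1 Ψ) 0 u ≠ 0) :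
    ∃ k K M δ : ℝ, 0 < k ∧ 0 < K ∧ 0 ≤ M ∧ 0 < δ ∧
      ∀ ρ ∈ Icc 0 δ, ∀ u ∈ Icc (-ustar) ustar, 0 ≤ charRHS Ψ Φ ρ u ∧
        (u ≤ 0 → k * √ρ ≤ charRHS Ψ Φ ρ u ∧ k * -u ≤ charRHS Ψ Φ ρ u ∧
          charRHS Ψ Φ ρ u ≤ K * (√ρ + -u)) ∧
        (0 ≤ u → charRHS Ψ Φ ρ u ≤ K * √ρ ∧
          u * charRHS Ψ Φ ρ u ≤ (1 / (2 * γ - 1) + M * (u + ρ)) * ρ) := by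
  have h0mem : (0:ℝ) ∈ Icc (-ustar) ustar := ⟨by linarith, hus.le⟩
  have hΨ1 := contDiff_pd1 hΨ
  have hΨ2 := contDiff_pd2 hΨ
  have hΦ1 := contDiff_pd1 hΦ
  have hΦ2 := contDiff_pd2 hΦ
  -- the coefficient `Φ_u - Ψ_ρ` vanishes at `u = 0`
  have hA0 : ∀ ρ ∈ Icc 0 ρstar, pd2 Φ ρ 0 - pd1 Ψ ρ 0 = 0 := by
    intro ρ hρ
    have h1 : pd1 Ψ ρ 0 = 0 := (hasDerivAt_pd1 hΨ ρ 0).eq_zero_of_eqOn_Icc hρs hρ fun x hx => by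
      have := hΨodd x hx 0 h0mem
      rw [neg_zero] at this
      linarith
    have h2 : pd2 Φ ρ 0 - pd2 Φ ρ (-0) * (-1) = 0 :=
      ((hasDerivAt_pd2 hΦ ρ 0).sub ((hasDerivAt_pd2 hΦ ρ (-0)).comp 0
        (hasDerivAt_neg (0:ℝ)))).eq_zero_of_eqOn_Icc (by linarith : -ustar < ustar) h0mem
        fun u hu => by simp [hΦeven ρ hρ u hu]
    rw [neg_zero] at h2
    linarith
  have hC0 : ∀ u ∈ Icc (-ustar) ustar, pd2 Ψ 0 u = 0 := fun u hu =>
    (hasDerivAt_pd2 hΨ 0 u).eq_zero_of_eqOn_Icc (by linarith : -ustar < ustar) hu hΨ0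
  have hAsmooth : ContDiff ℝ (⊤ : ℕ∞)
      (fun p : ℝ × ℝ => (fun ρ u => pd2 Φ ρ u - pd1 Ψ ρ u) p.1 p.2) := hΦ2.sub hΨ1
  have hCsmooth : ContDiff ℝ (⊤ : ℕ∞) (fun p : ℝ × ℝ => (fun u ρ => pd2 Ψ ρ u) p.1 p.2) :=
    hΨ2.comp (contDiff_snd.prodMk contDiff_fst)
  obtain ⟨a, hac, haeq, ha0, haL⟩ := exists_hadamard_quotient
    (f := fun ρ u => pd2 Φ ρ u - pd1 Ψ ρ u) hAsmooth
  obtain ⟨c, hcc, hceq, hc0, hcL⟩ := exists_hadamard_quotient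
    (f := fun u ρ => pd2 Ψ ρ u) hCsmooth
  have ha00 : a 0 0 = 2 * γ - 1 := by
    rw [ha0]
    have := ((hasDerivAt_pd2 hΦ2 0 0).sub (hasDerivAt_pd2 hΨ1 0 0)).deriv
    rw [hΨρu00] at this
    have h2 : pd2 (fun ρ u => pd2 Φ ρ u - pd1 Ψ ρ u) 0 0 = pd2 (pd2 Φ) 0 0 - 1 := this
    rw [h2]; linarith
  have hcu0 : ∀ u, c u 0 = pd2 (pd1 Ψ) 0 u := fun u => by
    rw [hc0, ← pd1_pd2_comm hΨ]; rfl
  have hc00 : c 0 0 = 1 := by rw [hcu0, hΨρu00]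
  obtain ⟨a₀, a₁, δ₁, ha₀, ha₁, hδ₁, hδ₁ρ, habd⟩ := exists_pos_bounds_near_segment hac hρs hus
    (by rw [ha00]; linarith) fun u hu hu' h => (hnondeg u hu hu').1 (by
      have := haeq 0 u
      simp only [hA0 0 ⟨le_rfl, hρs.le⟩, h] at this
      simpa using this)
  obtain ⟨b₀, b₁, δ₂, hb₀, hb₁, hδ₂, -, hbbd⟩ := exists_pos_bounds_near_segment
    hΦ1.continuous hρs hus (by rw [hΦρ00]; exact one_pos) fun u hu hu' => (hnondeg u hu hu').2.1
  obtain ⟨c₀, c₁, δ₃, hc₀, hc₁, hδ₃, -, hcbd⟩ := exists_pos_bounds_near_segment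
    (g := fun ρ u => c u ρ) (hcc.comp continuous_swap) hρs hus (by rw [hc00]; exact one_pos)
    fun u hu hu' => by rw [hcu0]; exact (hnondeg u hu hu').2.2
  obtain ⟨Ma, hMa0, hMa⟩ := haL (max ρstar ustar)
  obtain ⟨Mc, hMc0, hMc⟩ := hcL (max ρstar ustar)
  have hp : 0 < 2 * γ - 1 := by linarith
  obtain ⟨k, K, M, hk, hK, hM, hbd⟩ := quadratic_root_bounds (p := 1 / (2 * γ - 1))
    (M := Mc + 1 / (2 * γ - 1) * Ma) ha₀ ha₁ hb₀ hb₁ hc₀ hc₁ (by positivity)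
  refine ⟨k, K, M, min δ₁ (min δ₂ δ₃), hk, hK, hM, by positivity, ?_⟩
  intro ρ hρ u hu
  have hρ1 : ρ ≤ δ₁ := hρ.2.trans (min_le_left _ _)
  have hρ2 : ρ ≤ δ₂ := hρ.2.trans ((min_le_right _ _).trans (min_le_left _ _))
  have hρ3 : ρ ≤ δ₃ := hρ.2.trans ((min_le_right _ _).trans (min_le_right _ _))
  have hρabs : |ρ| ≤ max ρstar ustar := by
    rw [abs_of_nonneg hρ.1]; exact (hρ1.trans hδ₁ρ).trans (le_max_left _ _)
  have huabs : |u| ≤ max ρstar ustar := (abs_le.2 hu).trans (le_max_right _ _)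
  refine hbd (a ρ u) (pd1 Φ ρ u) (c u ρ) ρ u _ (habd ρ ⟨hρ.1, hρ1⟩ u hu).1
    (habd ρ ⟨hρ.1, hρ1⟩ u hu).2 (hbbd ρ ⟨hρ.1, hρ2⟩ u hu).1 (hbbd ρ ⟨hρ.1, hρ2⟩ u hu).2
    (hcbd ρ ⟨hρ.1, hρ3⟩ u hu).1 (hcbd ρ ⟨hρ.1, hρ3⟩ u hu).2 ?_ hρ.1 ?_
  · have h1 := (abs_le.1 (hMa ρ u hρabs huabs)).1
    have h2 := (abs_le.1 (hMc u ρ huabs hρabs)).2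
    rw [ha00] at h1
    rw [hc00] at h2
    rw [abs_of_nonneg hρ.1] at h1 h2
    have h3 := mul_le_mul_of_nonneg_left h1 (by positivity : 0 ≤ 1 / (2 * γ - 1))
    have h4 : 1 / (2 * γ - 1) * (2 * γ - 1) = 1 := by field_simp
    linarith
  · have h1 := haeq ρ u
    have h2 := hceq u ρ
    simp only [hA0 ρ ⟨hρ.1, hρ1.trans hδ₁ρ⟩, zero_add] at h1
    simp only [hC0 u hu, zero_add] at h2
    rw [charRHS, h1, h2]

end FluxBounds

/-- Bounds on the characteristic curves σ(u;r) of the Lax entropy equation,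
for γ > 1 (paper's Lemma 1): there are 0 < C₂ < C₁ and r₀ > 0 such that every
solution of the characteristic ODE through (r,0) with r ≤ r₀, staying in D,
satisfies r + C₁√r·u ≤ σ(u) ≤ r + C₂√r·u for u ≤ 0 and
r ≤ σ(u) ≤ r + C₁·min(√r·u, r^{(4γ−3)/(4γ−2)} u^{1/(2γ−1)}) for u ≥ 0, and is
monotone increasing. -/
theorem stmt_9 (ρstar ustar : ℝ) (hρs : 0 < ρstar) (hus : 0 < ustar)
    (Ψ Φ : ℝ → ℝ → ℝ)
    (hΨ : ContDiff ℝ (⊤ : ℕ∞) (fun p : ℝ × ℝ => Ψ p.1 p.2))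
    (hΦ : ContDiff ℝ (⊤ : ℕ∞) (fun p : ℝ × ℝ => Φ p.1 p.2))
    (hΨodd : ∀ ρ ∈ Icc (0:ℝ) ρstar, ∀ u ∈ Icc (-ustar) ustar, Ψ ρ (-u) = -Ψ ρ u)
    (hΦeven : ∀ ρ ∈ Icc (0:ℝ) ρstar, ∀ u ∈ Icc (-ustar) ustar, Φ ρ (-u) = Φ ρ u)
    (hΨ0 : ∀ u ∈ Icc (-ustar) ustar, Ψ 0 u = 0)
    (hΨρu00 : pd2 (pd1 Ψ) 0 0 = 1)
    (hΦρ00 : pd1 Φ 0 0 = 1)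
    (γ : ℝ) (hγdef : γ = pd2 (pd2 Φ) 0 0 / 2) (hγ : 1 < γ)
    (hdisc : ∀ ρ ∈ Icc (0:ℝ) ρstar, ∀ u ∈ Icc (-ustar) ustar,
        0 ≤ (pd2 Φ ρ u - pd1 Ψ ρ u)^2 + 4 * pd1 Φ ρ u * pd2 Ψ ρ u)
    (hnondeg : ∀ u : ℝ, 0 < |u| → |u| ≤ ustar →
        pd2 Φ 0 u - pd1 Ψ 0 u ≠ 0 ∧ pd1 Φ 0 u ≠ 0 ∧ pd2 (pd1 Ψ) 0 u ≠ 0) :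
    ∃ C₁ C₂ r₀ : ℝ, 0 < C₂ ∧ C₂ < C₁ ∧ 0 < r₀ ∧
      ∀ r ∈ Icc (0:ℝ) r₀, ∀ (σ : ℝ → ℝ) (I : Set ℝ),
        (0:ℝ) ∈ I → I.OrdConnected → σ 0 = r →
        (∀ u ∈ I, (σ u, u) ∈ Icc (0:ℝ) ρstar ×ˢ Icc (-ustar) ustar) →
        (∀ u ∈ I, HasDerivAt σ (charRHS Ψ Φ (σ u) u) u) →
        (∀ u ∈ I, u ≤ 0 →
            r + C₁ * Real.sqrt r * u ≤ σ u ∧ σ u ≤ r + C₂ * Real.sqrt r * u) ∧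
        (∀ u ∈ I, 0 ≤ u → r ≤ σ u ∧
            σ u ≤ r + C₁ * min (Real.sqrt r * u)
              (r ^ ((4*γ-3)/(4*γ-2)) * u ^ (1/(2*γ-1)))) ∧
        MonotoneOn σ I := by
  obtain ⟨k, K, M, δ, hk, hK, hM, hδ, hF⟩ := charRHS_bounds hρs hus hΨ hΦ hΨodd hΦeven hΨ0 hΨρu00
    hΦρ00 hγdef hγ hnondeg
  obtain ⟨A, B, hA, hB, hleft⟩ := left_bounds_of_slope hk hK
  have hp : 0 < 2 * γ - 1 := by linarith
  have hp1 : 1 / (2 * γ - 1) ≤ 1 := by rw [div_le_one hp]; linarith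
  obtain ⟨C, hC, hright⟩ := right_bounds_of_slope (p := 1 / (2 * γ - 1)) hK hM hp1 hus
  have hexp : 1 - 1 / (2 * γ - 1) / 2 = (4 * γ - 3) / (4 * γ - 2) := by
    have h1 : 4 * γ - 2 = 2 * (2 * γ - 1) := by ring
    rw [h1]
    field_simp
    ring
  rw [hexp] at hright
  set η : ℝ := min 1 (δ / (2 * (1 + C * ustar))) with hη
  have hη0 : 0 < η := by positivity
  have hηδ : (1 + C * ustar) * η < δ := by
    have h1 : (1 + C * ustar) * η ≤ (1 + C * ustar) * (δ / (2 * (1 + C * ustar))) := by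
      gcongr; exact min_le_right _ _
    have h2 : (1 + C * ustar) * (δ / (2 * (1 + C * ustar))) = δ / 2 := by field_simp
    linarith
  refine ⟨max A C + B, B, η ^ 2, hB, by linarith [hA.trans_le (le_max_left A C)], by positivity, ?_⟩
  rintro r ⟨hr0, hr⟩ σ I hI0 hI rfl hD hd
  have hsη : √(σ 0) ≤ η := Real.sqrt_le_iff.2 ⟨hη0.le, hr⟩
  have hsmall : σ 0 + C * (√(σ 0) * ustar) < δ := by
    have h1 : σ 0 ≤ η := hr.trans (by
      have : η ≤ 1 := min_le_left _ _
      nlinarith)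
    have h2 : C * (√(σ 0) * ustar) ≤ C * (η * ustar) := by gcongr
    linarith
  have hσ0δ : σ 0 < δ := by
    have : 0 ≤ C * (√(σ 0) * ustar) := by positivity
    linarith
  have hIr : ∀ x ∈ I, ∀ u ∈ Icc 0 x, u ∈ I := fun x hx u hu => hI.out hI0 hx hu
  have hIl : ∀ x ∈ I, ∀ u ∈ Icc x 0, u ∈ I := fun x hx u hu => hI.out hx hI0 hu
  have hcont : ∀ u ∈ I, ContinuousAt σ u := fun u hu => (hd u hu).continuousAt
  have hR : ∀ x ∈ I, 0 ≤ x → (∀ u ∈ Icc 0 x, σ u ≤ δ) →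
      σ x ≤ σ 0 + C * min (√(σ 0) * x) (σ 0 ^ ((4*γ-3)/(4*γ-2)) * x ^ (1/(2*γ-1))) := by
    intro x hx hx0 hle
    refine hright σ _ x hx0 (hD x hx).2.2 (fun u hu => hd u (hIr x hx u hu))
      (fun u hu => (hD u (hIr x hx u hu)).1.1) fun u hu => ?_
    have hu' := hD u (hIr x hx u hu)
    have h1 := hF (σ u) ⟨hu'.1.1, hle u hu⟩ u hu'.2
    exact ⟨h1.1, (h1.2.2 hu.1).1, (h1.2.2 hu.1).2⟩
  have hδr : ∀ x ∈ I, 0 ≤ x → σ x < δ := by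
    intro x hx hx0
    refine lt_of_forall_le_imp_lt (fun u hu => (hcont u (hIr x hx u hu)).continuousWithinAt) hσ0δ
      (fun u hu hle => ?_) x ⟨hx0, le_rfl⟩
    have hu' := hIr x hx u hu
    have h1 : C * min (√(σ 0) * u) (σ 0 ^ ((4*γ-3)/(4*γ-2)) * u ^ (1/(2*γ-1))) ≤
        C * (√(σ 0) * ustar) := by
      refine mul_le_mul_of_nonneg_left ((min_le_left _ _).trans ?_) hC.le
      exact mul_le_mul_of_nonneg_left (hD u hu').2.2 (Real.sqrt_nonneg _)
    linarith [hR u hu' hu.1 hle]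
  have hδl : ∀ x ∈ I, x ≤ 0 → σ x < δ := by
    intro x hx hx0
    have hneg : ∀ u ∈ Icc 0 (-x), -u ∈ I := fun u hu =>
      hIl x hx (-u) ⟨by linarith [hu.2], by linarith [hu.1]⟩
    have h := lt_of_forall_le_imp_lt (f := fun u => σ (-u)) (a := 0) (b := -x) (L := δ)
      (fun u hu => ((hcont _ (hneg u hu)).comp continuousAt_neg).continuousWithinAt)
      (by simpa using hσ0δ)
      (fun u hu hle => by
        have hmem : ∀ v ∈ Icc (-u) 0, v ∈ I := hIl _ (hneg u hu)
        have h1 : σ (-u) ≤ σ 0 := le_of_hasDerivAt_nonneg (by linarith [hu.1])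
          (fun v hv => hd v (hmem v hv)) fun v hv => by
            have hv' : v ∈ Icc (-u) 0 := ⟨hv.1.le, hv.2.le⟩
            have h2 := hle (-v) ⟨by linarith [hv.2], by linarith [hv.1]⟩
            rw [neg_neg] at h2
            have h3 := hD v (hmem v hv')
            exact (hF (σ v) ⟨h3.1.1, h2⟩ v h3.2).1
        exact h1.trans_lt hσ0δ)
      (-x) ⟨by linarith, le_rfl⟩
    simpa using h
  have hδI : ∀ x ∈ I, σ x ≤ δ := fun x hx =>
    (le_total x 0).elim (fun h => (hδl x hx h).le) fun h => (hδr x hx h).le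
  have hFI : ∀ u ∈ I, _ := fun u hu => hF (σ u) ⟨(hD u hu).1.1, hδI u hu⟩ u (hD u hu).2
  have hmono : MonotoneOn σ I := fun x hx y hy hxy =>
    le_of_hasDerivAt_nonneg hxy (fun v hv => hd v (hI.out hx hy hv))
      fun v hv => (hFI v (hI.out hx hy ⟨hv.1.le, hv.2.le⟩)).1
  refine ⟨fun u hu hu0 => ?_, fun u hu hu0 => ⟨hmono hI0 hu hu0, ?_⟩, hmono⟩
  · obtain ⟨h1, h2⟩ := hleft σ _ u hu0 (fun v hv => hd v (hIl u hu v hv))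
      (fun v hv => (hD v (hIl u hu v hv)).1.1) fun v hv => (hFI v (hIl u hu v hv)).2.1 hv.2
    refine ⟨?_, h2⟩
    have h3 : A ≤ max A C + B := (le_max_left A C).trans (by linarith)
    have h4 : A * (√(σ 0) * -u) ≤ (max A C + B) * (√(σ 0) * -u) :=
      mul_le_mul_of_nonneg_right h3 (mul_nonneg (Real.sqrt_nonneg _) (by linarith))
    linarith
  · have h1 := hR u hu hu0 fun v hv => hδI v (hIr u hu v hv)
    have h3 : C ≤ max A C + B := (le_max_right A C).trans (by linarith)
    have h4 : 0 ≤ min (√(σ 0) * u) (σ 0 ^ ((4*γ-3)/(4*γ-2)) * u ^ (1/(2*γ-1))) :=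
      le_min (by positivity) (by positivity)
    exact h1.trans (by gcongr)
end

section
/- Let 0 < r̲ < r̄, K > 0 and C₁ ≥ 1, and let G : [0,∞) × ℝ → ℝ be differentiable with partial derivatives satisfying |G_ρ(ρ,u)| ≤ K(√r̄ + |u|) and |G_u(ρ,u)| ≤ K(ρ + √r̄ |u|) for all (ρ,u), such that G(ρ,u) = 0 whenever ρ ≤ r̲ − C₁ √r̲ |u|, and G_ρ(ρ,u) = G_u(ρ,u) = 0 whenever ρ > r̄ + C₁ √r̄ |u|. Then there exists a constant C′ < ∞ depending only on C₁ such that |G(ρ,u)| ≤ C′ K √r̄ (r̄ + u²) for all (ρ,u) ∈ [0,∞) × ℝ. -/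
/-- Quantitative bound on the entropy-flux discrepancy: a differentiable
function G on [0,∞)×ℝ vanishing on {ρ ≤ r̲ − C₁√r̲|u|}, with vanishing gradient
on {ρ > r̄ + C₁√r̄|u|} and gradient bounds |G_ρ| ≤ K(√r̄+|u|),
|G_u| ≤ K(ρ+√r̄|u|), satisfies |G| ≤ C′K√r̄(r̄+u²) with C′ depending only on
C₁. -/
theorem stmt_10 (C₁ : ℝ) (hC₁ : 1 ≤ C₁) :
    ∃ C' : ℝ, ∀ rlo rhi K : ℝ, 0 < rlo → rlo < rhi → 0 < K →
      ∀ G : ℝ → ℝ → ℝ,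
        Differentiable ℝ (fun p : ℝ × ℝ => G p.1 p.2) →
        (∀ ρ u : ℝ, 0 ≤ ρ → |pd1 G ρ u| ≤ K * (Real.sqrt rhi + |u|)) →
        (∀ ρ u : ℝ, 0 ≤ ρ → |pd2 G ρ u| ≤ K * (ρ + Real.sqrt rhi * |u|)) →
        (∀ ρ u : ℝ, 0 ≤ ρ → ρ ≤ rlo - C₁ * Real.sqrt rlo * |u| → G ρ u = 0) →
        (∀ ρ u : ℝ, 0 ≤ ρ → rhi + C₁ * Real.sqrt rhi * |u| < ρ →
          pd1 G ρ u = 0 ∧ pd2 G ρ u = 0) →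
        ∀ ρ u : ℝ, 0 ≤ ρ →
          |G ρ u| ≤ C' * K * Real.sqrt rhi * (rhi + u^2) := by
  refine ⟨1 + 2 * C₁, ?_⟩
  intro rlo rhi K hlo hlt hK G hG h1 h2 h0 hfar ρ u hρ
  have hrhi : 0 < rhi := hlo.trans hlt
  have hd1 : ∀ v x, DifferentiableAt ℝ (fun x' => G x' v) x := fun v x =>
    (hG (x, v)).comp x (f := fun x' : ℝ => (x', v)) (by fun_prop)
  have hd2 : ∀ x v, DifferentiableAt ℝ (fun y' => G x y') v := fun x v =>
    (hG (x, v)).comp v (f := fun y' : ℝ => (x, y')) (by fun_prop)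
  set s := Real.sqrt rhi with hs
  have hs0 : 0 ≤ s := Real.sqrt_nonneg _
  have hss : rhi = s * s := (Real.mul_self_sqrt hrhi.le).symm
  have hu0 : 0 ≤ |u| := abs_nonneg u
  have hKs : 0 ≤ K * s := by positivity
  have hG00 : G 0 0 = 0 := h0 0 0 le_rfl (by simpa using hlo.le)
  have haxis : |G 0 u| ≤ K * s * u ^ 2 := by
    have h := (convex_uIcc (0 : ℝ) u).norm_image_sub_le_of_norm_deriv_le
      (f := fun y' => G 0 y') (C := K * (s * |u|)) (fun v _ => hd2 0 v)
      (fun v hv => by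
        have hvu : |v| ≤ |u| := by simpa using Set.abs_sub_left_of_mem_uIcc hv
        have h := h2 0 v le_rfl
        rw [zero_add] at h
        exact h.trans (by gcongr))
      Set.left_mem_uIcc Set.right_mem_uIcc
    simp only [hG00, sub_zero, Real.norm_eq_abs] at h
    rw [← sq_abs]
    linarith
  have hline : ∀ x, 0 ≤ x → |G x u - G 0 u| ≤ K * (s + |u|) * x := by
    intro x hx
    have h := (convex_Ici (0 : ℝ)).norm_image_sub_le_of_norm_deriv_le
      (f := fun x' => G x' u) (C := K * (s + |u|)) (fun v _ => hd1 u v)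
      (fun v hv => h1 v u hv) (Set.mem_Ici.2 le_rfl) (Set.mem_Ici.2 hx)
    simpa [abs_of_nonneg hx] using h
  have hnear : ∀ x, 0 ≤ x → x ≤ rhi + C₁ * s * |u| →
      |G x u| ≤ (1 + 2 * C₁) * K * s * (rhi + u ^ 2) := by
    intro x hx hxM
    have hprod : (s + |u|) * (s + C₁ * |u|) ≤ 2 * C₁ * (s ^ 2 + |u| ^ 2) := by
      have hle : s + C₁ * |u| ≤ C₁ * (s + |u|) := by nlinarith
      calc (s + |u|) * (s + C₁ * |u|) ≤ (s + |u|) * (C₁ * (s + |u|)) := by gcongr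
        _ ≤ 2 * C₁ * (s ^ 2 + |u| ^ 2) := by
          nlinarith [mul_nonneg (by linarith : 0 ≤ C₁) (sq_nonneg (s - |u|))]
    have hincr : |G x u - G 0 u| ≤ K * s * (2 * C₁ * (s ^ 2 + |u| ^ 2)) :=
      calc |G x u - G 0 u| ≤ K * (s + |u|) * x := hline x hx
        _ ≤ K * (s + |u|) * (rhi + C₁ * s * |u|) := by gcongr
        _ = K * s * ((s + |u|) * (s + C₁ * |u|)) := by rw [hss]; ring
        _ ≤ _ := by gcongr
    have htri : |G x u| ≤ |G x u - G 0 u| + |G 0 u| := by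
      simpa using abs_add_le (G x u - G 0 u) (G 0 u)
    rw [sq_abs] at hincr
    have hrest : 0 ≤ K * s * rhi := by positivity
    have hsq : s ^ 2 = rhi := by rw [hss]; ring
    rw [hsq] at hincr
    linarith
  have hM : 0 ≤ rhi + C₁ * s * |u| := by positivity
  rcases le_or_gt ρ (rhi + C₁ * s * |u|) with hle | hgt
  · exact hnear ρ hρ hle
  · obtain ⟨ξ, hξ, hslope⟩ := exists_deriv_eq_slope (fun x' => G x' u) hgt
      (fun x _ => (hd1 u x).continuousAt.continuousWithinAt)
      (fun x _ => (hd1 u x).differentiableWithinAt)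
    have hzero : deriv (fun x' => G x' u) ξ = 0 :=
      (hfar ξ u (hM.trans hξ.1.le) hξ.1).1
    rw [hzero, eq_comm, div_eq_zero_iff] at hslope
    have hconst : G ρ u = G (rhi + C₁ * s * |u|) u :=
      sub_eq_zero.1 (hslope.resolve_right (sub_pos.2 hgt).ne')
    rw [hconst]
    exact hnear _ hM le_rfl
end

section
/- Let 0 ≤ y₁ < y₂ ≤ x₁ < x₂ < ∞ and R := [x₁,x₂] × [y₁,y₂]. Let A, B be continuously differentiable and C continuous on R with sup_{z∈[y₁,y₂]} ∫_{x₁}^{x₂} |B(s,z)| ds < 1/6, sup_{w∈[x₁,x₂]} ∫_{y₁}^{y₂} |A(w,t)| dt < 1/6, and ∫_{x₁}^{x₂} ∫_{y₁}^{y₂} |C(s,t)| ds dt < 1/6. Let U be twice continuously differentiable on R and satisfy U_{wz} − (AU)_w − (BU)_z + CU = 0 on R, and set M := sup_{y₁ ≤ z ≤ y₂} |U(x₁,z)| + sup_{x₁ ≤ w ≤ x₂} |U(w,y₂)|. Then sup_{(w,z) ∈ R} |U(w,z)| ≤ 5M. -/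
open Set intervalIntegral

/-- Partial derivative in the first variable, as a value of the Fréchet derivative. -/
theorem hasDerivAt_partial_fst {F : ℝ → ℝ → ℝ} (hF : ContDiff ℝ 1 (fun p : ℝ × ℝ => F p.1 p.2))
    (s t : ℝ) :
    HasDerivAt (fun s' => F s' t) (fderiv ℝ (fun p : ℝ × ℝ => F p.1 p.2) (s, t) (1, 0)) s :=
  ((hF.differentiable one_ne_zero) (s, t)).hasFDerivAt.comp_hasDerivAt (f := fun s' => (s', t)) s
    ((hasDerivAt_id s).prodMk (hasDerivAt_const s t))

/-- Partial derivative in the second variable, as a value of the Fréchet derivative. -/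
theorem hasDerivAt_partial_snd {F : ℝ → ℝ → ℝ} (hF : ContDiff ℝ 1 (fun p : ℝ × ℝ => F p.1 p.2))
    (s t : ℝ) :
    HasDerivAt (fun t' => F s t') (fderiv ℝ (fun p : ℝ × ℝ => F p.1 p.2) (s, t) (0, 1)) t :=
  ((hF.differentiable one_ne_zero) (s, t)).hasFDerivAt.comp_hasDerivAt (f := fun t' => (s, t')) t
    ((hasDerivAt_const t s).prodMk (hasDerivAt_id t))

theorem continuous_deriv_fst {F : ℝ → ℝ → ℝ} (hF : ContDiff ℝ 1 (fun p : ℝ × ℝ => F p.1 p.2)) :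
    Continuous (fun p : ℝ × ℝ => deriv (fun s' => F s' p.2) p.1) := by
  simp_rw [fun s t => (hasDerivAt_partial_fst hF s t).deriv]
  exact (hF.continuous_fderiv one_ne_zero).clm_apply continuous_const

theorem continuous_deriv_snd {F : ℝ → ℝ → ℝ} (hF : ContDiff ℝ 1 (fun p : ℝ × ℝ => F p.1 p.2)) :
    Continuous (fun p : ℝ × ℝ => deriv (fun t' => F p.1 t') p.2) := by
  simp_rw [fun s t => (hasDerivAt_partial_snd hF s t).deriv]
  exact (hF.continuous_fderiv one_ne_zero).clm_apply continuous_const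

theorem contDiff_deriv_fst {F : ℝ → ℝ → ℝ} (hF : ContDiff ℝ 2 (fun p : ℝ × ℝ => F p.1 p.2)) :
    ContDiff ℝ 1 (fun p : ℝ × ℝ => deriv (fun s' => F s' p.2) p.1) := by
  simp_rw [fun s t => (hasDerivAt_partial_fst (hF.of_le one_le_two) s t).deriv]
  exact (hF.fderiv_right (m := 1) (by norm_num)).clm_apply contDiff_const

theorem integral_deriv_fst {F : ℝ → ℝ → ℝ} (hF : ContDiff ℝ 1 (fun p : ℝ × ℝ => F p.1 p.2))
    (a b t : ℝ) : ∫ s in a..b, deriv (fun s' => F s' t) s = F b t - F a t :=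
  integral_deriv_eq_sub (f := fun s' => F s' t)
    (fun s _ => (hasDerivAt_partial_fst hF s t).differentiableAt)
    (((continuous_deriv_fst hF).comp (continuous_id.prodMk continuous_const)).intervalIntegrable _ _)

theorem integral_deriv_snd {F : ℝ → ℝ → ℝ} (hF : ContDiff ℝ 1 (fun p : ℝ × ℝ => F p.1 p.2))
    (c d s : ℝ) : ∫ t in c..d, deriv (fun t' => F s t') t = F s d - F s c :=
  integral_deriv_eq_sub (f := fun t' => F s t')
    (fun t _ => (hasDerivAt_partial_snd hF s t).differentiableAt)
    (((continuous_deriv_snd hF).comp (continuous_const.prodMk continuous_id)).intervalIntegrable _ _)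

theorem integral_integral_comm {f : ℝ → ℝ → ℝ} (hf : Continuous (fun p : ℝ × ℝ => f p.1 p.2))
    (a b c d : ℝ) :
    ∫ s in a..b, ∫ t in c..d, f s t = ∫ t in c..d, ∫ s in a..b, f s t := by
  refine MeasureTheory.intervalIntegral_intervalIntegral_swap ?_
  exact (hf.continuousOn.integrableOn_compact (isCompact_uIcc.prod isCompact_uIcc)).mono_set
    (prod_mono uIoc_subset_uIcc uIoc_subset_uIcc)

/-- The integrated form of `U_{wz} − (AU)_w − (BU)_z + CU = 0` on `[a, b] × [c, d]`. -/
theorem goursat_integral_identity {A B C U : ℝ → ℝ → ℝ} {a b c d : ℝ} (hab : a ≤ b) (hcd : c ≤ d)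
    (hA : ContDiff ℝ 1 (fun p : ℝ × ℝ => A p.1 p.2))
    (hB : ContDiff ℝ 1 (fun p : ℝ × ℝ => B p.1 p.2))
    (hC : Continuous (fun p : ℝ × ℝ => C p.1 p.2))
    (hU : ContDiff ℝ 2 (fun p : ℝ × ℝ => U p.1 p.2))
    (hPDE : ∀ w ∈ Icc a b, ∀ z ∈ Icc c d,
      deriv (fun z' => deriv (fun w' => U w' z') w) z
        - deriv (fun w' => A w' z * U w' z) w
        - deriv (fun z' => B w z' * U w z') z
        + C w z * U w z = 0) :
    U b c = U b d - U a d + U a c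
      - (∫ t in c..d, A b t * U b t) + (∫ t in c..d, A a t * U a t)
      - (∫ s in a..b, B s d * U s d) + (∫ s in a..b, B s c * U s c)
      + ∫ s in a..b, ∫ t in c..d, C s t * U s t := by
  have hU1 : ContDiff ℝ 1 (fun p : ℝ × ℝ => U p.1 p.2) := hU.of_le one_le_two
  have hUw := contDiff_deriv_fst hU
  have hAU : ContDiff ℝ 1 (fun p : ℝ × ℝ => A p.1 p.2 * U p.1 p.2) := hA.mul hU1
  have hBU : ContDiff ℝ 1 (fun p : ℝ × ℝ => B p.1 p.2 * U p.1 p.2) := hB.mul hU1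
  have hCU : Continuous (fun p : ℝ × ℝ => C p.1 p.2 * U p.1 p.2) := hC.mul hU.continuous
  have hAUw := continuous_deriv_fst (F := fun w z => A w z * U w z) hAU
  have hUwz := continuous_deriv_snd (F := fun w z => deriv (fun w' => U w' z) w) hUw
  have hBUz := continuous_deriv_snd (F := fun w z => B w z * U w z) hBU
  have slice_snd {f : ℝ → ℝ → ℝ} (hf : Continuous (fun p : ℝ × ℝ => f p.1 p.2)) (s x y : ℝ) :
      IntervalIntegrable (fun t => f s t) MeasureTheory.volume x y :=
    (hf.comp (continuous_const.prodMk continuous_id)).intervalIntegrable _ _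
  have slice_fst {f : ℝ → ℝ → ℝ} (hf : Continuous (fun p : ℝ × ℝ => f p.1 p.2)) (t x y : ℝ) :
      IntervalIntegrable (fun s => f s t) MeasureTheory.volume x y :=
    (hf.comp (continuous_id.prodMk continuous_const)).intervalIntegrable _ _
  have outer {f : ℝ → ℝ → ℝ} (hf : Continuous (fun p : ℝ × ℝ => f p.1 p.2)) :
      IntervalIntegrable (fun s => ∫ t in c..d, f s t) MeasureTheory.volume a b :=
    (continuous_parametric_intervalIntegral_of_continuous' hf c d).intervalIntegrable _ _
  have inner : ∀ s ∈ Icc a b,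
      (deriv (fun w' => U w' d) s - deriv (fun w' => U w' c) s)
        - (∫ t in c..d, deriv (fun w' => A w' t * U w' t) s)
        - (B s d * U s d - B s c * U s c) + (∫ t in c..d, C s t * U s t) = 0 := by
    intro s hs
    have h0 : ∫ t in c..d, (deriv (fun z' => deriv (fun w' => U w' z') s) t
        - deriv (fun w' => A w' t * U w' t) s - deriv (fun z' => B s z' * U s z') t
        + C s t * U s t) = 0 := by
      rw [integral_congr (g := fun _ => (0 : ℝ)) fun t ht => hPDE s hs t (uIcc_of_le hcd ▸ ht)]
      simp
    have i1 := slice_snd (f := fun s t => deriv (fun z' => deriv (fun w' => U w' z') s) t) hUwz s c d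
    have i2 := slice_snd (f := fun s t => deriv (fun w' => A w' t * U w' t) s) hAUw s c d
    have i3 := slice_snd (f := fun s t => deriv (fun z' => B s z' * U s z') t) hBUz s c d
    have i4 := slice_snd (f := fun s t => C s t * U s t) hCU s c d
    rw [integral_add ((i1.sub i2).sub i3) i4, integral_sub (i1.sub i2) i3, integral_sub i1 i2,
      integral_deriv_snd (F := fun w z => deriv (fun w' => U w' z) w) hUw,
      integral_deriv_snd (F := fun w z => B w z * U w z) hBU] at h0
    exact h0
  have h0 : ∫ s in a..b, ((deriv (fun w' => U w' d) s - deriv (fun w' => U w' c) s)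
        - (∫ t in c..d, deriv (fun w' => A w' t * U w' t) s)
        - (B s d * U s d - B s c * U s c) + (∫ t in c..d, C s t * U s t)) = 0 := by
    rw [integral_congr (g := fun _ => (0 : ℝ)) fun s hs => inner s (uIcc_of_le hab ▸ hs)]
    simp
  have i1 (z : ℝ) := slice_fst (f := fun s t => deriv (fun w' => U w' t) s) hUw.continuous z a b
  have i2 := outer (f := fun s t => deriv (fun w' => A w' t * U w' t) s) hAUw
  have i3 (z : ℝ) := slice_fst (f := fun s t => B s t * U s t) hBU.continuous z a b
  have i4 := outer (f := fun s t => C s t * U s t) hCU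
  rw [integral_add ((((i1 d).sub (i1 c)).sub i2).sub ((i3 d).sub (i3 c))) i4,
    integral_sub (((i1 d).sub (i1 c)).sub i2) ((i3 d).sub (i3 c)),
    integral_sub ((i1 d).sub (i1 c)) i2, integral_sub (i1 d) (i1 c),
    integral_sub (i3 d) (i3 c), integral_deriv_fst hU1, integral_deriv_fst hU1,
    integral_integral_comm (f := fun s t => deriv (fun w' => A w' t * U w' t) s) hAUw] at h0
  simp_rw [integral_deriv_fst (F := fun w z => A w z * U w z) hAU] at h0
  rw [integral_sub (slice_snd (f := fun s t => A s t * U s t) hAU.continuous b c d)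
    (slice_snd (f := fun s t => A s t * U s t) hAU.continuous a c d)] at h0
  linarith

/-- A weighted integral is bounded by the integral of the weight over a larger interval times
a bound on the integrand. -/
theorem abs_integral_mul_le {f g : ℝ → ℝ} {a b c d m ε : ℝ} (hf : Continuous f)
    (hg : Continuous g) (hm : 0 ≤ m) (hca : c ≤ a) (hab : a ≤ b) (hbd : b ≤ d)
    (hgm : ∀ x ∈ Icc a b, |g x| ≤ m) (hε : ∫ x in c..d, |f x| ≤ ε) :
    |∫ x in a..b, f x * g x| ≤ ε * m := by
  calc |∫ x in a..b, f x * g x| ≤ ∫ x in a..b, |f x * g x| := abs_integral_le_integral_abs hab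
    _ ≤ ∫ x in a..b, |f x| * m := by
        refine integral_mono_on hab ((hf.mul hg).abs.intervalIntegrable _ _)
          ((hf.abs.mul continuous_const).intervalIntegrable _ _) fun x hx => ?_
        rw [abs_mul]
        exact mul_le_mul_of_nonneg_left (hgm x hx) (abs_nonneg _)
    _ = (∫ x in a..b, |f x|) * m := integral_mul_const _ _
    _ ≤ (∫ x in c..d, |f x|) * m := by
        refine mul_le_mul_of_nonneg_right (integral_mono_interval hca hab hbd
          (.of_forall fun x => abs_nonneg _) (hf.abs.intervalIntegrable _ _)) hm
    _ ≤ ε * m := mul_le_mul_of_nonneg_right hε hm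

theorem abs_integral_integral_mul_le {f g : ℝ → ℝ → ℝ} {a b a' b' c d c' d' m ε : ℝ}
    (hf : Continuous (fun p : ℝ × ℝ => f p.1 p.2)) (hg : Continuous (fun p : ℝ × ℝ => g p.1 p.2))
    (hm : 0 ≤ m) (ha : a' ≤ a) (hab : a ≤ b) (hb : b ≤ b') (hc : c' ≤ c) (hcd : c ≤ d)
    (hd : d ≤ d') (hgm : ∀ s ∈ Icc a b, ∀ t ∈ Icc c d, |g s t| ≤ m)
    (hε : ∫ s in a'..b', ∫ t in c'..d', |f s t| ≤ ε) :
    |∫ s in a..b, ∫ t in c..d, f s t * g s t| ≤ ε * m := by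
  have hcont := continuous_parametric_intervalIntegral_of_continuous'
    (μ := MeasureTheory.volume) (f := fun s t => |f s t|) hf.abs c' d'
  have hfg := continuous_parametric_intervalIntegral_of_continuous'
    (μ := MeasureTheory.volume) (f := fun s t => f s t * g s t) (hf.mul hg) c d
  calc |∫ s in a..b, ∫ t in c..d, f s t * g s t|
      ≤ ∫ s in a..b, |∫ t in c..d, f s t * g s t| := abs_integral_le_integral_abs hab
    _ ≤ ∫ s in a..b, (∫ t in c'..d', |f s t|) * m :=
        integral_mono_on hab (hfg.abs.intervalIntegrable _ _)
          ((hcont.mul continuous_const).intervalIntegrable _ _) fun s hs =>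
          abs_integral_mul_le (hf.comp (continuous_const.prodMk continuous_id))
            (hg.comp (continuous_const.prodMk continuous_id)) hm hc hcd hd (hgm s hs) le_rfl
    _ = (∫ s in a..b, ∫ t in c'..d', |f s t|) * m := integral_mul_const _ _
    _ ≤ (∫ s in a'..b', ∫ t in c'..d', |f s t|) * m := by
        refine mul_le_mul_of_nonneg_right (integral_mono_interval ha hab hb
          (.of_forall fun s => integral_nonneg (hc.trans (hcd.trans hd)) fun t _ => abs_nonneg _)
          (hcont.intervalIntegrable _ _)) hm
    _ ≤ ε * m := mul_le_mul_of_nonneg_right hε hm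

theorem le_sSup_image_Icc {f : ℝ → ℝ} (hf : Continuous f) {a b x : ℝ} (hx : x ∈ Icc a b) :
    f x ≤ sSup (f '' Icc a b) :=
  le_csSup (isCompact_Icc.bddAbove_image hf.continuousOn) (mem_image_of_mem f hx)

/-- Goursat-type a priori estimate: for the linear hyperbolic equation
U_{wz} − (AU)_w − (BU)_z + CU = 0 on the rectangle [x₁,x₂]×[y₁,y₂], with the
three smallness conditions on the coefficients, the solution is bounded by 5
times the sum of the sup of its boundary values on the sides w = x₁ and
z = y₂. -/
theorem stmt_11 (x₁ x₂ y₁ y₂ : ℝ)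
    (h1 : 0 ≤ y₁) (h2 : y₁ < y₂) (h3 : y₂ ≤ x₁) (h4 : x₁ < x₂)
    (A B C U : ℝ → ℝ → ℝ)
    (hA : ContDiff ℝ 1 (fun p : ℝ × ℝ => A p.1 p.2))
    (hB : ContDiff ℝ 1 (fun p : ℝ × ℝ => B p.1 p.2))
    (hC : Continuous (fun p : ℝ × ℝ => C p.1 p.2))
    (hU : ContDiff ℝ 2 (fun p : ℝ × ℝ => U p.1 p.2))
    (hBint : sSup ((fun z => ∫ s in x₁..x₂, |B s z|) '' Icc y₁ y₂) < 1/6)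
    (hAint : sSup ((fun w => ∫ t in y₁..y₂, |A w t|) '' Icc x₁ x₂) < 1/6)
    (hCint : (∫ s in x₁..x₂, ∫ t in y₁..y₂, |C s t|) < 1/6)
    (hPDE : ∀ w ∈ Icc x₁ x₂, ∀ z ∈ Icc y₁ y₂,
      deriv (fun z' => deriv (fun w' => U w' z') w) z
        - deriv (fun w' => A w' z * U w' z) w
        - deriv (fun z' => B w z' * U w z') z
        + C w z * U w z = 0) :
    ∀ w ∈ Icc x₁ x₂, ∀ z ∈ Icc y₁ y₂,
      |U w z| ≤ 5 * (sSup ((fun z' => |U x₁ z'|) '' Icc y₁ y₂)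
                     + sSup ((fun w' => |U w' y₂|) '' Icc x₁ x₂)) := by
  have hUc : Continuous (fun p : ℝ × ℝ => U p.1 p.2) := hU.continuous
  have hAc : Continuous (fun p : ℝ × ℝ => A p.1 p.2) := hA.continuous
  have hBc : Continuous (fun p : ℝ × ℝ => B p.1 p.2) := hB.continuous
  have snd {f : ℝ → ℝ → ℝ} (hf : Continuous (fun p : ℝ × ℝ => f p.1 p.2)) (s : ℝ) :
      Continuous (fun t => f s t) := hf.comp (continuous_const.prodMk continuous_id)
  have fst {f : ℝ → ℝ → ℝ} (hf : Continuous (fun p : ℝ × ℝ => f p.1 p.2)) (t : ℝ) :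
      Continuous (fun s => f s t) := hf.comp (continuous_id.prodMk continuous_const)
  set m₁ := sSup ((fun z' => |U x₁ z'|) '' Icc y₁ y₂)
  set m₂ := sSup ((fun w' => |U w' y₂|) '' Icc x₁ x₂)
  have hm₁ : ∀ z ∈ Icc y₁ y₂, |U x₁ z| ≤ m₁ := fun z hz => le_sSup_image_Icc (snd hUc x₁).abs hz
  have hm₂ : ∀ w ∈ Icc x₁ x₂, |U w y₂| ≤ m₂ := fun w hw => le_sSup_image_Icc (fst hUc y₂).abs hw
  have hA6 : ∀ w ∈ Icc x₁ x₂, ∫ t in y₁..y₂, |A w t| ≤ 1 / 6 := fun w hw =>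
    (le_sSup_image_Icc (continuous_parametric_intervalIntegral_of_continuous'
      (f := fun w t => |A w t|) hAc.abs y₁ y₂) hw).trans hAint.le
  have hB6 : ∀ z ∈ Icc y₁ y₂, ∫ s in x₁..x₂, |B s z| ≤ 1 / 6 := fun z hz =>
    (le_sSup_image_Icc (continuous_parametric_intervalIntegral_of_continuous'
      (f := fun z s => |B s z|) (hBc.comp continuous_swap).abs x₁ x₂) hz).trans hBint.le
  have hx₁ : x₁ ∈ Icc x₁ x₂ := left_mem_Icc.2 h4.le
  have hy₂ : y₂ ∈ Icc y₁ y₂ := right_mem_Icc.2 h2.le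
  have hm₁0 : 0 ≤ m₁ := (abs_nonneg _).trans (hm₁ y₂ hy₂)
  have hm₂0 : 0 ≤ m₂ := (abs_nonneg _).trans (hm₂ x₁ hx₁)
  obtain ⟨⟨w₀, z₀⟩, ⟨hw₀, hz₀⟩, hmax⟩ := (isCompact_Icc.prod isCompact_Icc).exists_isMaxOn
    (⟨(x₁, y₂), hx₁, hy₂⟩ : (Icc x₁ x₂ ×ˢ Icc y₁ y₂).Nonempty) hUc.abs.continuousOn
  set K := |U w₀ z₀| with hKdef
  have hK : ∀ w ∈ Icc x₁ x₂, ∀ z ∈ Icc y₁ y₂, |U w z| ≤ K := fun w hw z hz =>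
    hmax (show (w, z) ∈ Icc x₁ x₂ ×ˢ Icc y₁ y₂ from ⟨hw, hz⟩)
  have hK0 : 0 ≤ K := abs_nonneg _
  have hsubw : Icc x₁ w₀ ⊆ Icc x₁ x₂ := Icc_subset_Icc_right hw₀.2
  have hsubz : Icc z₀ y₂ ⊆ Icc y₁ y₂ := Icc_subset_Icc_left hz₀.1
  have hid := goursat_integral_identity hw₀.1 hz₀.2 hA hB hC hU
    fun w hw z hz => hPDE w (hsubw hw) z (hsubz hz)
  have bAw := abs_integral_mul_le (snd hAc w₀) (snd hUc w₀) hK0 hz₀.1 hz₀.2 le_rfl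
    (fun t ht => hK w₀ hw₀ t (hsubz ht)) (hA6 w₀ hw₀)
  have bAx := abs_integral_mul_le (snd hAc x₁) (snd hUc x₁) hm₁0 hz₀.1 hz₀.2 le_rfl
    (fun t ht => hm₁ t (hsubz ht)) (hA6 x₁ hx₁)
  have bBy := abs_integral_mul_le (fst hBc y₂) (fst hUc y₂) hm₂0 le_rfl hw₀.1 hw₀.2
    (fun s hs => hm₂ s (hsubw hs)) (hB6 y₂ hy₂)
  have bBz := abs_integral_mul_le (fst hBc z₀) (fst hUc z₀) hK0 le_rfl hw₀.1 hw₀.2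
    (fun s hs => hK s (hsubw hs) z₀ hz₀) (hB6 z₀ hz₀)
  have bC := abs_integral_integral_mul_le hC hUc hK0 le_rfl hw₀.1 hw₀.2 hz₀.1 hz₀.2 le_rfl
    (fun s hs t ht => hK s (hsubw hs) t (hsubz ht)) hCint.le
  have bU₁ := hm₂ w₀ hw₀
  have bU₂ := hm₁ y₂ hy₂
  have bU₃ := hm₁ z₀ hz₀
  have hKM : K ≤ 5 * (m₁ + m₂) := by
    rw [abs_le] at bAw bAx bBy bBz bC bU₁ bU₂ bU₃
    rcases abs_cases (U w₀ z₀) with ⟨h, -⟩ | ⟨h, -⟩ <;> rw [← hKdef] at h <;> linarith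
  exact fun w hw z hz => (hK w hw z hz).trans hKM
end

section
/- Let Ω be a finite nonempty set, and let n, l ∈ ℕ with 1 ≤ l ≤ n and l dividing n. Let ν = ⊗_{j∈ℤ/nℤ} ν_j be a product probability measure on Ω^{ℤ/nℤ} (with possibly different factors ν_j), and let μ be an arbitrary probability measure on Ω^{ℤ/nℤ}. Let V : Ω^l → ℝ and set V_j(ω) := V(ω_j, ω_{j+1}, …, ω_{j+l−1}) with indices taken mod n. Then for every κ > 0: E_μ[ (1/n) Σ_{j∈ℤ/nℤ} V_j ] ≤ (l/(κn)) H(μ|ν) + (1/(κn)) Σ_{j∈ℤ/nℤ} log E_ν[ exp(κ V_j) ]. -/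
open Finset

/-- The Gibbs variational inequality on a finite type. -/
theorem sum_mul_le_relEntropy_add_log_sum_exp {α : Type*} [Fintype α] {p q : α → ℝ}
    (hp0 : ∀ a, 0 ≤ p a) (hp1 : ∑ a, p a = 1) (hq0 : ∀ a, 0 ≤ q a)
    (hac : ∀ a, q a = 0 → p a = 0) (F : α → ℝ) :
    ∑ a, p a * F a ≤
      ∑ a, p a * Real.log (p a / q a) + Real.log (∑ a, q a * Real.exp (F a)) := by
  set Z := ∑ a, q a * Real.exp (F a) with hZ
  have hterm0 : ∀ a, 0 ≤ q a * Real.exp (F a) := fun a => mul_nonneg (hq0 a) (Real.exp_pos _).le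
  have hZpos : 0 < Z := by
    obtain ⟨a, -, ha⟩ : ∃ a ∈ univ, p a ≠ 0 := by
      by_contra! h
      rw [Finset.sum_eq_zero h] at hp1
      exact zero_ne_one hp1
    have hqa : 0 < q a := lt_of_le_of_ne (hq0 a) fun h => ha (hac a h.symm)
    exact Finset.sum_pos' (fun a _ => hterm0 a) ⟨a, mem_univ a, by positivity⟩
  have key : ∀ a, p a * F a ≤
      p a * Real.log (p a / q a) + p a * Real.log Z + (q a * Real.exp (F a) / Z - p a) := by
    intro a
    rcases (hp0 a).eq_or_lt with hpa | hpa
    · simpa [← hpa] using div_nonneg (hterm0 a) hZpos.le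
    · have hqa : 0 < q a := lt_of_le_of_ne (hq0 a) fun h => hpa.ne' (hac a h.symm)
      have hx : 0 < q a * Real.exp (F a) / (Z * p a) := by positivity
      have hlog := mul_le_mul_of_nonneg_left (Real.log_le_sub_one_of_pos hx) hpa.le
      rw [Real.log_div (by positivity) (by positivity), Real.log_mul hqa.ne' (Real.exp_pos _).ne',
        Real.log_mul hZpos.ne' hpa.ne', Real.log_exp] at hlog
      rw [Real.log_div hpa.ne' hqa.ne']
      have hcancel : p a * (q a * Real.exp (F a) / (Z * p a) - 1)
          = q a * Real.exp (F a) / Z - p a := by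
        field_simp
      linarith
  calc ∑ a, p a * F a ≤ _ := Finset.sum_le_sum fun a _ => key a
    _ = _ := by
      rw [Finset.sum_add_distrib, Finset.sum_add_distrib, Finset.sum_sub_distrib,
        ← Finset.sum_mul, ← Finset.sum_div, ← hZ, hp1, div_self hZpos.ne']
      ring

section BlockProduct

variable {Ω B I J : Type*} [Fintype Ω] [Fintype B] [Fintype I] [Fintype J] [DecidableEq B]
  [DecidableEq I] [DecidableEq J]

theorem sum_prod_mul_prod_block (e : B × I ≃ J) (w : J → Ω → ℝ) (f : B → (I → Ω) → ℝ) :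
    ∑ σ : J → Ω, (∏ j, w j (σ j)) * ∏ b, f b (fun i => σ (e (b, i)))
      = ∏ b, ∑ x : I → Ω, (∏ i, w (e (b, i)) (x i)) * f b x := by
  rw [Fintype.prod_sum,
    ← (((e.symm.arrowCongr (Equiv.refl Ω)).trans (Equiv.curry B I Ω)).sum_comp)]
  refine Finset.sum_congr rfl fun σ _ => ?_
  rw [Finset.prod_mul_distrib, ← e.prod_comp, Fintype.prod_prod_type]
  rfl

/-- The marginal of a product weight on a single block. -/
theorem sum_prod_mul_block (e : B × I ≃ J) (w : J → Ω → ℝ) (hw : ∀ j, ∑ ω, w j ω = 1)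
    (b : B) (g : (I → Ω) → ℝ) :
    ∑ σ : J → Ω, (∏ j, w j (σ j)) * g (fun i => σ (e (b, i)))
      = ∑ x : I → Ω, (∏ i, w (e (b, i)) (x i)) * g x := by
  have h := sum_prod_mul_prod_block e w (fun b' x => if b' = b then g x else 1)
  have hone : ∀ b', ∑ x : I → Ω, ∏ i, w (e (b', i)) (x i) = 1 := fun b' => by
    rw [← Fintype.prod_sum]
    exact Finset.prod_eq_one fun i _ => hw _
  simp only [Finset.prod_ite_eq', Finset.mem_univ, if_true] at h
  rw [h, Finset.prod_eq_single b (fun b' _ hb' => by simp [hb', hone]) (by simp)]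
  simp

/-- Functions of disjoint blocks of coordinates are independent under a product weight. -/
theorem sum_prod_mul_prod_block_eq_prod (e : B × I ≃ J) (w : J → Ω → ℝ)
    (hw : ∀ j, ∑ ω, w j ω = 1) (f : B → (I → Ω) → ℝ) :
    ∑ σ : J → Ω, (∏ j, w j (σ j)) * ∏ b, f b (fun i => σ (e (b, i)))
      = ∏ b, ∑ σ : J → Ω, (∏ j, w j (σ j)) * f b (fun i => σ (e (b, i))) := by
  rw [sum_prod_mul_prod_block]
  exact Finset.prod_congr rfl fun b _ => (sum_prod_mul_block e w hw b (f b)).symm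

/-- The entropy inequality for a sum of functions of disjoint blocks of coordinates. -/
theorem sum_mul_sum_block_le (e : B × I ≃ J) {w : J → Ω → ℝ}
    (hw0 : ∀ j ω, 0 ≤ w j ω) (hw1 : ∀ j, ∑ ω, w j ω = 1)
    {μ : (J → Ω) → ℝ} (hμ0 : ∀ σ, 0 ≤ μ σ) (hμ1 : ∑ σ, μ σ = 1)
    (hac : ∀ σ, (∏ j, w j (σ j)) = 0 → μ σ = 0) (f : B → (I → Ω) → ℝ) :
    ∑ σ, μ σ * ∑ b, f b (fun i => σ (e (b, i)))
      ≤ ∑ σ, μ σ * Real.log (μ σ / ∏ j, w j (σ j))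
        + ∑ b, Real.log (∑ σ : J → Ω, (∏ j, w j (σ j)) *
            Real.exp (f b (fun i => σ (e (b, i))))) := by
  have hq0 : ∀ σ : J → Ω, 0 ≤ ∏ j, w j (σ j) := fun σ => Finset.prod_nonneg fun j _ => hw0 j _
  have hq1 : ∑ σ : J → Ω, ∏ j, w j (σ j) = 1 := by
    rw [← Fintype.prod_sum]
    exact Finset.prod_eq_one fun j _ => hw1 j
  have hpos : ∀ F : (J → Ω) → ℝ, 0 < ∑ σ : J → Ω, (∏ j, w j (σ j)) * Real.exp (F σ) := by
    intro F
    obtain ⟨σ, -, hσ⟩ : ∃ σ ∈ (univ : Finset (J → Ω)), (∏ j, w j (σ j)) ≠ 0 := by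
      by_contra! h
      rw [Finset.sum_eq_zero h] at hq1
      exact zero_ne_one hq1
    exact Finset.sum_pos' (fun σ _ => mul_nonneg (hq0 σ) (Real.exp_pos _).le)
      ⟨σ, mem_univ σ, mul_pos ((hq0 σ).lt_of_ne' hσ) (Real.exp_pos _)⟩
  rw [← Real.log_prod fun b _ => (hpos _).ne',
    ← sum_prod_mul_prod_block_eq_prod e w hw1 fun b x => Real.exp (f b x)]
  simp only [← Real.exp_sum]
  exact sum_mul_le_relEntropy_add_log_sum_exp hμ0 hμ1 hq0 hac _

end BlockProduct

theorem bijective_zmod_block (k l : ℕ) [NeZero (k * l)] :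
    Function.Bijective fun p : Fin k × Fin l =>
      (((p.1 : ℕ) * l : ℕ) : ZMod (k * l)) + ((p.2 : ℕ) : ZMod (k * l)) := by
  rw [Fintype.bijective_iff_injective_and_card]
  refine ⟨fun p q h => finProdFinEquiv.injective (Fin.ext ?_), by simp [ZMod.card]⟩
  have hval : ∀ p : Fin k × Fin l, (((p.1 : ℕ) * l : ℕ) : ZMod (k * l)) + ((p.2 : ℕ) : ZMod (k * l))
      = ((finProdFinEquiv p : ℕ) : ZMod (k * l)) := fun p => by
    simp [mul_comm, add_comm]
  simp only [hval] at h
  have hv := congrArg ZMod.val h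
  rwa [ZMod.val_cast_of_lt (finProdFinEquiv p).isLt,
    ZMod.val_cast_of_lt (finProdFinEquiv q).isLt] at hv

/-- Fixed-time entropy inequality on the discrete torus: for a product
reference measure ν and any probability measure μ on Ω^{ℤ/nℤ}, and a local
function V of l consecutive (cyclic) coordinates with l ∣ n,
E_μ[(1/n) Σ_j V_j] ≤ (l/(κn)) H(μ|ν) + (1/(κn)) Σ_j log E_ν[exp(κ V_j)]. -/
theorem stmt_13 {Ω : Type} [Fintype Ω] [Nonempty Ω] (n l : ℕ) [NeZero n]
    (hl1 : 1 ≤ l) (hln : l ≤ n) (hdvd : l ∣ n)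
    (νf : ZMod n → Ω → ℝ) (hνf0 : ∀ j ω, 0 ≤ νf j ω) (hνf1 : ∀ j, ∑ ω, νf j ω = 1)
    (μ : (ZMod n → Ω) → ℝ) (hμ0 : ∀ σ, 0 ≤ μ σ) (hμ1 : ∑ σ, μ σ = 1)
    (hac : ∀ σ, (∏ j, νf j (σ j)) = 0 → μ σ = 0)
    (V : (Fin l → Ω) → ℝ) (κ : ℝ) (hκ : 0 < κ) :
    ∑ σ : ZMod n → Ω, μ σ *
        ((n:ℝ)⁻¹ * ∑ j : ZMod n, V (fun i : Fin l => σ (j + ((i : ℕ) : ZMod n))))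
      ≤ (l / (κ * n)) *
          (∑ σ : ZMod n → Ω, μ σ * Real.log (μ σ / ∏ j, νf j (σ j)))
        + (κ * n)⁻¹ * ∑ j : ZMod n,
            Real.log (∑ σ : ZMod n → Ω,
              (∏ j', νf j' (σ j')) *
                Real.exp (κ * V (fun i : Fin l => σ (j + ((i : ℕ) : ZMod n))))) := by
  classical
  obtain ⟨k, rfl⟩ := exists_eq_mul_left_of_dvd hdvd
  let e : Fin k × Fin l ≃ ZMod (k * l) := Equiv.ofBijective _ (bijective_zmod_block k l)
  have hsum : ∀ g : ZMod (k * l) → ℝ,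
      ∑ i : Fin l, ∑ b : Fin k, g (((i : ℕ) : ZMod (k * l)) + (((b : ℕ) * l : ℕ) : ZMod (k * l)))
        = ∑ j, g j := fun g => by
    rw [Finset.sum_comm, ← e.sum_comp, Fintype.sum_prod_type]
    refine Finset.sum_congr rfl fun b _ => Finset.sum_congr rfl fun i _ => ?_
    rw [add_comm]
    rfl
  have hblock : ∀ r : ZMod (k * l), _ := fun r =>
    sum_mul_sum_block_le (e.trans (Equiv.addLeft r)) hνf0 hνf1 hμ0 hμ1 hac
      (fun _ x => κ * V x)
  have he : ∀ (r : ZMod (k * l)) (b : Fin k) (i : Fin l), (e.trans (Equiv.addLeft r)) (b, i)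
      = r + (((b : ℕ) * l : ℕ) : ZMod (k * l)) + ((i : ℕ) : ZMod (k * l)) := fun r b i =>
    (add_assoc _ _ _).symm
  simp only [he] at hblock
  have htotal := Finset.sum_le_sum fun (i : Fin l) (_ : i ∈ univ) => hblock ((i : ℕ) : ZMod (k * l))
  rw [Finset.sum_add_distrib, Finset.sum_comm,
    hsum fun j => Real.log (∑ σ : ZMod (k * l) → Ω, (∏ j', νf j' (σ j')) *
      Real.exp (κ * V (fun i : Fin l => σ (j + ((i : ℕ) : ZMod (k * l))))))] at htotal
  simp only [← Finset.mul_sum] at htotal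
  have hV : ∀ σ : ZMod (k * l) → Ω, _ := fun σ =>
    hsum fun j => V (fun i : Fin l => σ (j + ((i : ℕ) : ZMod (k * l))))
  simp only [hV, Finset.sum_const, Finset.card_univ, Fintype.card_fin, nsmul_eq_mul] at htotal
  have hn : (0 : ℝ) < ((k * l : ℕ) : ℝ) := Nat.cast_pos.mpr (NeZero.pos _)
  have hscaled := mul_le_mul_of_nonneg_left htotal (inv_pos.mpr (mul_pos hκ hn)).le
  refine (le_of_eq ?_).trans (hscaled.trans (le_of_eq ?_))
  · rw [Finset.mul_sum]
    refine Finset.sum_congr rfl fun σ _ => ?_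
    field_simp
  · rw [mul_add, ← mul_assoc, div_eq_inv_mul]
end

section
/- For every M > 0 there exists a bounded real random variable Y (on some probability space) with E[Y] = 0 such that for every r ∈ ℝ: r² · 1_{|r| ≤ M} ≤ log E[ exp(rY) ]. -/
open MeasureTheory

lemma exp_le_one_add_mul_exp (s : ℝ) : Real.exp s ≤ 1 + s * Real.exp s := by
  have h := mul_le_mul_of_nonneg_left (Real.add_one_le_exp (-s)) (Real.exp_pos s).le
  rw [← Real.exp_add, add_neg_cancel, Real.exp_zero] at h
  linarith

lemma one_add_sq_div_two_le_cosh (x : ℝ) : 1 + x ^ 2 / 2 ≤ Real.cosh x := by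
  have h : (x / 2) ^ 2 ≤ Real.sinh (x / 2) ^ 2 := by
    rw [sq_le_sq, Real.abs_sinh]
    exact Real.self_le_sinh_iff.2 (abs_nonneg _)
  have h₂ := Real.cosh_two_mul (x / 2)
  rw [mul_div_cancel₀ x two_ne_zero, Real.cosh_sq] at h₂
  linarith

lemma exp_sq_le_cosh {M r : ℝ} (hr : |r| ≤ M) :
    Real.exp (r ^ 2) ≤ Real.cosh (r * (2 * Real.exp (M ^ 2))) := by
  refine le_trans ?_ (one_add_sq_div_two_le_cosh _)
  have hrM : r ^ 2 ≤ M ^ 2 := sq_le_sq' (abs_le.1 hr).1 (abs_le.1 hr).2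
  have hexp : r ^ 2 * Real.exp (r ^ 2) ≤ r ^ 2 * Real.exp (M ^ 2) := by gcongr
  have hone : 1 ≤ Real.exp (M ^ 2) := Real.one_le_exp (sq_nonneg M)
  have hsq : r ^ 2 * Real.exp (M ^ 2) ≤ r ^ 2 * Real.exp (M ^ 2) ^ 2 := by
    gcongr
    nlinarith
  nlinarith [exp_le_one_add_mul_exp (r ^ 2),
    mul_nonneg (sq_nonneg r) (sq_nonneg (Real.exp (M ^ 2)))]

/-- The law of a fair coin. -/
noncomputable def fairCoin : Measure Bool :=
  (2⁻¹ : ENNReal) • Measure.dirac true + (2⁻¹ : ENNReal) • Measure.dirac false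

instance : IsProbabilityMeasure fairCoin :=
  ⟨by simp [fairCoin, ENNReal.inv_two_add_inv_two]⟩

lemma integral_fairCoin (f : Bool → ℝ) :
    ∫ ω, f ω ∂fairCoin = (f true + f false) / 2 := by
  rw [integral_fintype Integrable.of_finite]
  simp [fairCoin, Measure.real]
  ring

/-- For every M > 0 there exists a centered bounded real random variable Y
(on some probability space) whose logarithmic moment generating function
dominates r² on [−M, M]. -/
theorem stmt_15 (M : ℝ) (hM : 0 < M) :
    ∃ (Ωs : Type) (mΩ : MeasurableSpace Ωs) (P : Measure Ωs)
      (_ : IsProbabilityMeasure P) (Y : Ωs → ℝ) (K : ℝ),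
      Measurable Y ∧ (∀ ω, |Y ω| ≤ K) ∧ (∫ ω, Y ω ∂P) = 0 ∧
      ∀ r : ℝ, (if |r| ≤ M then r^2 else 0) ≤
        Real.log (∫ ω, Real.exp (r * Y ω) ∂P) := by
  set c : ℝ := 2 * Real.exp (M ^ 2)
  have hc₀ : 0 ≤ c := by positivity
  refine ⟨Bool, inferInstance, fairCoin, inferInstance, fun ω => if ω then c else -c, c,
    measurable_of_finite _, ?_, ?_, fun r => ?_⟩
  · rintro (_ | _) <;> simp [abs_of_nonneg hc₀]
  · simp [integral_fairCoin]
  · have hmgf : ∫ ω : Bool, Real.exp (r * if ω then c else -c) ∂fairCoin = Real.cosh (r * c) := by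
      simp [integral_fairCoin, Real.cosh_eq]
    rw [hmgf]
    split_ifs with hr
    · rw [Real.le_log_iff_exp_le (Real.cosh_pos _)]
      exact exp_sq_le_cosh hr
    · exact Real.log_nonneg (Real.one_le_cosh _)
end

section
/- Suppose ∫₀¹ b(s) ds = 0. Then there exists a constant C < ∞, depending only on m, the joint law of (ξ, ζ) and the function b, such that for every l ∈ ℕ, every x ∈ ℝ^d with P(ζ̄_l = x) > 0, and every γ ∈ ℝ: E[ exp{ γ √l · ⟨b,ξ⟩_l } | ζ̄_l = x ] ≤ exp{ C (γ² + |γ|/√l) }. -/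
open Finset
open scoped Classical

/-- Product weight of a configuration under the i.i.d. law π. -/
noncomputable def wt {Ω : Type} [Fintype Ω] (π : Ω → ℝ) {k : ℕ}
    (σ : Fin k → Ω) : ℝ := ∏ i, π (σ i)

/-- ξ_j(σ) := ξ(ω_j, …, ω_{j+m−1}) (0-based window starting at j). -/
noncomputable def xiAt {Ω : Type} {m : ℕ} (ξ : (Fin m → Ω) → ℝ) {l : ℕ}
    (σ : Fin (l + m) → Ω) (j : Fin l) : ℝ :=
  ξ (fun i : Fin m => σ ⟨j.1 + i.1, by have := j.isLt; have := i.isLt; omega⟩)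

/-- Weighted block average ⟨b,ξ⟩_l = (1/l) Σ_{j=1}^{l} b(j/l) ξ_j. -/
noncomputable def bAvg {Ω : Type} (b : ℝ → ℝ) {m : ℕ} (ξ : (Fin m → Ω) → ℝ)
    {l : ℕ} (σ : Fin (l + m) → Ω) : ℝ :=
  (l : ℝ)⁻¹ * ∑ j : Fin l, b (((j.1 : ℝ) + 1) / l) * xiAt ξ σ j

/-- Plain block average ζ̄_l = (1/l) Σ_{j=1}^{l} ζ_j (vector valued). -/
noncomputable def zAvg {Ω : Type} {d : ℕ} (ζ : Ω → Fin d → ℝ) {l m : ℕ}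
    (σ : Fin (l + m) → Ω) : Fin d → ℝ :=
  fun i => (l : ℝ)⁻¹ * ∑ j : Fin l, ζ (σ ⟨j.1, by have := j.isLt; omega⟩) i

/-- Conditional expectation E[f | ζ̄_l = x] under the i.i.d. law π. -/
noncomputable def condExp {Ω : Type} [Fintype Ω] (π : Ω → ℝ) {d : ℕ}
    (ζ : Ω → Fin d → ℝ) {l m : ℕ} (x : Fin d → ℝ)
    (f : (Fin (l + m) → Ω) → ℝ) : ℝ :=
  (∑ σ : Fin (l + m) → Ω, if zAvg ζ σ = x then wt π σ * f σ else 0) /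
  (∑ σ : Fin (l + m) → Ω, if zAvg ζ σ = x then wt π σ else 0)

theorem exists_riemann_sum_bound (b : ℝ → ℝ) (hb : ContDiff ℝ (⊤ : ℕ∞) b)
    (hb0 : (∫ s in (0:ℝ)..1, b s) = 0) :
    ∃ L : ℝ, 0 ≤ L ∧ ∀ l : ℕ, 0 < l → |∑ j : Fin l, b (((j.1 : ℝ) + 1) / l)| ≤ L := by
  obtain ⟨K, hK⟩ := (hb.contDiffOn (s := Set.Icc (0:ℝ) 1)).exists_lipschitzOnWith
    (by simp) (convex_Icc 0 1) isCompact_Icc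
  refine ⟨K, K.2, fun l hl => ?_⟩
  have hl' : (0:ℝ) < l := by exact_mod_cast hl
  have hint : ∀ x y : ℝ, IntervalIntegrable b MeasureTheory.volume x y :=
    fun x y => hb.continuous.intervalIntegrable x y
  have hsplit := intervalIntegral.sum_integral_adjacent_intervals (f := b)
    (μ := MeasureTheory.volume) (a := fun k : ℕ => (k:ℝ) / l) (n := l) (fun k _ => hint _ _)
  simp only [Nat.cast_zero, zero_div, div_self hl'.ne', hb0] at hsplit
  have hterm : ∀ k ∈ Finset.range l,
      |b (((k:ℝ) + 1) / l) - l * ∫ s in ((k:ℝ) / l)..(((k + 1 : ℕ):ℝ) / l), b s| ≤ K / l := by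
    intro k hk
    have hkl : (k:ℝ) + 1 ≤ l := by exact_mod_cast Finset.mem_range.1 hk
    have hk0 : (0:ℝ) ≤ k := k.cast_nonneg
    have hwidth : (((k + 1 : ℕ):ℝ) / l) - (k:ℝ) / l = 1 / l := by push_cast; ring
    have hlt : (k:ℝ) / l ≤ ((k + 1 : ℕ):ℝ) / l := by
      have : (0:ℝ) < 1 / l := by positivity
      linarith
    have hconst : ∫ _s in ((k:ℝ) / l)..(((k + 1 : ℕ):ℝ) / l), b (((k:ℝ) + 1) / l)
        = (1 / l) * b (((k:ℝ) + 1) / l) := by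
      rw [intervalIntegral.integral_const, hwidth, smul_eq_mul]
    have hdiff : b (((k:ℝ) + 1) / l) - l * ∫ s in ((k:ℝ) / l)..(((k + 1 : ℕ):ℝ) / l), b s
        = l * ∫ s in ((k:ℝ) / l)..(((k + 1 : ℕ):ℝ) / l), (b (((k:ℝ) + 1) / l) - b s) := by
      rw [intervalIntegral.integral_sub (by simp) (hint _ _), hconst]
      field_simp
    have hbound := intervalIntegral.norm_integral_le_of_norm_le_const (C := (K:ℝ) / l)
      (a := (k:ℝ) / l) (b := ((k + 1 : ℕ):ℝ) / l)
      (f := fun s => b (((k:ℝ) + 1) / l) - b s) (by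
        intro s hs
        rw [Set.uIoc_of_le hlt] at hs
        have h1 : ((k + 1 : ℕ):ℝ) / l ≤ 1 := by
          rw [div_le_one hl']; push_cast; exact hkl
        have h0 : 0 ≤ (k:ℝ) / l := by positivity
        have hd := hK.dist_le_mul (((k + 1 : ℕ):ℝ) / l) ⟨h0.trans hlt, h1⟩ s
          ⟨h0.trans hs.1.le, hs.2.trans h1⟩
        rw [Real.dist_eq, Real.dist_eq, abs_of_nonneg (sub_nonneg.2 hs.2)] at hd
        push_cast at hd hwidth hs ⊢
        rw [Real.norm_eq_abs]
        refine hd.trans ?_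
        rw [div_eq_mul_one_div (K:ℝ)]
        refine mul_le_mul_of_nonneg_left ?_ K.2
        linarith [hs.1])
    rw [hwidth, abs_of_pos (by positivity), Real.norm_eq_abs] at hbound
    rw [hdiff, abs_mul, abs_of_pos hl']
    calc _ ≤ (l:ℝ) * (K / l * (1 / l)) := mul_le_mul_of_nonneg_left hbound hl'.le
      _ = K / l := by field_simp
  have hsum : ∑ j : Fin l, b (((j.1 : ℝ) + 1) / l) = ∑ k ∈ Finset.range l,
      (b (((k:ℝ) + 1) / l) - l * ∫ s in ((k:ℝ) / l)..(((k + 1 : ℕ):ℝ) / l), b s) := by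
    rw [Finset.sum_sub_distrib, ← Finset.mul_sum, hsplit, mul_zero, sub_zero,
      Fin.sum_univ_eq_sum_range (fun k => b (((k:ℝ) + 1) / l)) l]
  rw [hsum]
  refine (Finset.abs_sum_le_sum_abs _ _).trans ((Finset.sum_le_sum hterm).trans ?_)
  rw [Finset.sum_const, Finset.card_range, nsmul_eq_mul]
  exact le_of_eq (by field_simp)

/-- Jensen's inequality for the exponential and a uniform average. -/
theorem exp_average_le {ι : Type*} [Fintype ι] [Nonempty ι] (f : ι → ℝ) :
    Real.exp ((∑ i, f i) / Fintype.card ι) ≤ (∑ i, Real.exp (f i)) / Fintype.card ι := by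
  have hc : (0:ℝ) < Fintype.card ι := by exact_mod_cast Fintype.card_pos
  have h := convexOn_exp.map_sum_le (t := Finset.univ) (w := fun _ : ι => (Fintype.card ι : ℝ)⁻¹)
    (p := f) (fun _ _ => by positivity) (by simp [hc.ne']) (fun _ _ => Set.mem_univ _)
  simpa only [smul_eq_mul, ← Finset.mul_sum, div_eq_inv_mul] using h

/-- A form of Hoeffding's lemma for uniform averages, obtained by symmetrization. -/
theorem sum_exp_le_of_abs_sub_le {ι : Type*} [Fintype ι] [Nonempty ι] (f : ι → ℝ) (c : ℝ)
    (hf : ∀ i j, |f i - f j| ≤ c) :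
    ∑ i, Real.exp (f i)
      ≤ Fintype.card ι * Real.exp ((∑ i, f i) / Fintype.card ι + c ^ 2 / 2) := by
  have hc : (0:ℝ) < Fintype.card ι := by exact_mod_cast Fintype.card_pos
  have hJ := exp_average_le (fun i => - f i)
  have hdouble : (∑ i, Real.exp (f i)) * (∑ j, Real.exp (- f j))
      ≤ (Fintype.card ι : ℝ) ^ 2 * Real.exp (c ^ 2 / 2) := by
    have h1 : (∑ i, Real.exp (f i)) * (∑ j, Real.exp (- f j))
        = ∑ i, ∑ j, Real.exp (f i - f j) := by
      rw [Finset.sum_mul_sum]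
      simp only [← Real.exp_add, sub_eq_add_neg]
    have h2 : ∑ i, ∑ j, Real.exp (f i - f j) = ∑ i, ∑ j, Real.cosh (f i - f j) := by
      have h3 : ∑ i, ∑ j, Real.exp (f i - f j) = ∑ i, ∑ j, Real.exp (-(f i - f j)) := by
        rw [Finset.sum_comm]
        simp only [neg_sub]
      simp only [Real.cosh_eq, add_div, Finset.sum_add_distrib, ← Finset.sum_div]
      rw [← h3]; ring
    rw [h1, h2]
    calc _ ≤ ∑ _i : ι, ∑ _j : ι, Real.exp (c ^ 2 / 2) := by
          refine Finset.sum_le_sum fun i _ => Finset.sum_le_sum fun j _ => ?_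
          refine (Real.cosh_le_exp_half_sq _).trans (Real.exp_le_exp.2 ?_)
          have := sq_le_sq' (abs_le.1 (hf i j)).1 (abs_le.1 (hf i j)).2
          linarith
      _ = _ := by simp [sq, mul_assoc]
  have hpos : 0 ≤ ∑ i, Real.exp (f i) := Finset.sum_nonneg fun i _ => (Real.exp_pos _).le
  rw [le_div_iff₀ hc] at hJ
  rw [Finset.sum_neg_distrib, neg_div] at hJ
  set A := (∑ i, f i) / (Fintype.card ι : ℝ)
  have hmul : (∑ i, Real.exp (f i)) * (Real.exp (-A) * Fintype.card ι)
      ≤ (Fintype.card ι : ℝ) ^ 2 * Real.exp (c ^ 2 / 2) :=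
    (mul_le_mul_of_nonneg_left hJ hpos).trans hdouble
  have hE : Real.exp A * Real.exp (-A) = 1 := by rw [← Real.exp_add]; simp
  rw [Real.exp_add]
  have h := mul_le_mul_of_nonneg_left hmul (Real.exp_pos A).le
  refine le_of_mul_le_mul_right ?_ hc
  linear_combination h + (∑ i, Real.exp (f i)) * (Fintype.card ι : ℝ) * (-hE)

theorem decomposeFin_symm_eq_swap_mul {n : ℕ} (p : Fin (n + 1)) (e : Equiv.Perm (Fin n)) :
    Equiv.Perm.decomposeFin.symm (p, e)
      = Equiv.swap 0 p * Equiv.Perm.decomposeFin.symm (0, e) := by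
  ext k
  refine Fin.cases ?_ (fun k => ?_) k <;> simp

theorem decomposeFin_symm_zero_swap_mul {n : ℕ} (i j : Fin n) (e : Equiv.Perm (Fin n)) :
    Equiv.Perm.decomposeFin.symm (0, Equiv.swap i j * e)
      = Equiv.swap i.succ j.succ * Equiv.Perm.decomposeFin.symm (0, e) := by
  ext k
  refine Fin.cases ?_ (fun k => ?_) k
  · simp [Equiv.swap_apply_of_ne_of_ne (Fin.succ_ne_zero i).symm (Fin.succ_ne_zero j).symm]
  · simp [(Fin.succ_injective n).swap_apply]

/-- Bounded differences inequality for a uniformly distributed random permutation. -/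
theorem sum_exp_perm_le {n : ℕ} (F : Equiv.Perm (Fin n) → ℝ) (c : ℝ)
    (hF : ∀ i j σ, |F (Equiv.swap i j * σ) - F σ| ≤ c) :
    ∑ σ, Real.exp (F σ)
      ≤ n.factorial * Real.exp ((∑ σ, F σ) / n.factorial + n * (2 * c ^ 2)) := by
  induction n with
  | zero => simp
  | succ n ih =>
    have hn : (0:ℝ) < n.factorial := by exact_mod_cast n.factorial_pos
    let G : Fin (n + 1) → Equiv.Perm (Fin n) → ℝ :=
      fun p e => F (Equiv.Perm.decomposeFin.symm (p, e))
    have hsum : ∀ H : Equiv.Perm (Fin (n + 1)) → ℝ,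
        ∑ σ, H σ = ∑ p, ∑ e, H (Equiv.Perm.decomposeFin.symm (p, e)) := by
      intro H
      rw [← Fintype.sum_prod_type', Equiv.sum_comp Equiv.Perm.decomposeFin.symm H]
    have hG : ∀ p i j e, |G p (Equiv.swap i j * e) - G p e| ≤ c := by
      intro p i j e
      simp only [G]
      rw [decomposeFin_symm_eq_swap_mul p e, decomposeFin_symm_eq_swap_mul p (_ * e),
        decomposeFin_symm_zero_swap_mul, ← mul_assoc, Equiv.mul_swap_eq_swap_mul, mul_assoc]
      exact hF _ _ _
    let M : Fin (n + 1) → ℝ := fun p => (∑ e, G p e) / n.factorial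
    have hM : ∀ p q, |M p - M q| ≤ 2 * c := by
      intro p q
      have hpq : ∀ e, |G p e - G q e| ≤ 2 * c := by
        intro e
        have h1 := hF 0 p (Equiv.Perm.decomposeFin.symm (0, e))
        have h2 := hF 0 q (Equiv.Perm.decomposeFin.symm (0, e))
        simp only [G]
        rw [decomposeFin_symm_eq_swap_mul p e, decomposeFin_symm_eq_swap_mul q e]
        rw [abs_le] at *
        constructor <;> linarith [h1.1, h1.2, h2.1, h2.2]
      simp only [M]
      rw [← sub_div, ← Finset.sum_sub_distrib, abs_div, abs_of_pos hn, div_le_iff₀ hn]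
      refine (Finset.abs_sum_le_sum_abs _ _).trans
        ((Finset.sum_le_sum fun e _ => hpq e).trans (le_of_eq ?_))
      simp [Fintype.card_perm, mul_comm]
    have hstep := sum_exp_le_of_abs_sub_le M (2 * c) hM
    rw [hsum (fun σ => Real.exp (F σ)), hsum F]
    calc _ ≤ ∑ p, n.factorial * Real.exp (M p + n * (2 * c ^ 2)) :=
          Finset.sum_le_sum fun p _ => ih (G p) (hG p)
      _ = (n.factorial * Real.exp (n * (2 * c ^ 2))) * ∑ p, Real.exp (M p) := by
          rw [Finset.mul_sum]
          refine Finset.sum_congr rfl fun p _ => ?_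
          rw [Real.exp_add]; ring
      _ ≤ (n.factorial * Real.exp (n * (2 * c ^ 2))) * _ :=
          mul_le_mul_of_nonneg_left hstep (by positivity)
      _ = _ := by
          have hav : (∑ p, M p) / (Fintype.card (Fin (n + 1)) : ℝ)
              = (∑ p, ∑ e, F (Equiv.Perm.decomposeFin.symm (p, e))) / (n + 1).factorial := by
            simp only [M, G, ← Finset.sum_div, Fintype.card_fin, Nat.factorial_succ]
            push_cast
            field_simp
          rw [hav, Real.exp_add, Real.exp_add, Fintype.card_fin, Nat.factorial_succ]
          have : ((n + 1 : ℕ):ℝ) * (2 * c ^ 2) = n * (2 * c ^ 2) + (2 * c) ^ 2 / 2 := by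
            push_cast; ring
          rw [this, Real.exp_add]
          push_cast
          ring

theorem weight_point_mem_Icc {l : ℕ} (j : Fin l) :
    ((j.1 : ℝ) + 1) / l ∈ Set.Icc (0:ℝ) 1 := by
  have hj : (j.1 : ℝ) + 1 ≤ l := by exact_mod_cast j.isLt
  exact ⟨by positivity, div_le_one_of_le₀ hj (by positivity)⟩

/-- The action of a permutation of the first `l` sites on all `l + m` sites. -/
noncomputable def blockPerm (l m : ℕ) : Equiv.Perm (Fin l) →* Equiv.Perm (Fin (l + m)) :=
  Equiv.Perm.viaEmbeddingHom (Fin.castAddEmb m)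

theorem blockPerm_castAdd {l m : ℕ} (σ : Equiv.Perm (Fin l)) (j : Fin l) :
    blockPerm l m σ (Fin.castAdd m j) = Fin.castAdd m (σ j) :=
  Equiv.Perm.viaEmbedding_apply σ (Fin.castAddEmb m) j

theorem blockPerm_natAdd {l m : ℕ} (σ : Equiv.Perm (Fin l)) (j : Fin m) :
    blockPerm l m σ (Fin.natAdd l j) = Fin.natAdd l j := by
  refine Equiv.Perm.viaEmbedding_apply_of_notMem σ (Fin.castAddEmb m) _ ?_
  rintro ⟨i, hi⟩
  have h := congrArg Fin.val hi
  have := i.isLt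
  simp at h
  omega

theorem wt_comp_blockPerm {Ω : Type} [Fintype Ω] (π : Ω → ℝ) {l m : ℕ}
    (σ : Equiv.Perm (Fin l)) (v : Fin (l + m) → Ω) :
    wt π (v ∘ blockPerm l m σ) = wt π v :=
  Equiv.prod_comp (blockPerm l m σ) (fun i => π (v i))

theorem zAvg_comp_blockPerm {Ω : Type} {d : ℕ} (ζ : Ω → Fin d → ℝ) {l m : ℕ}
    (σ : Equiv.Perm (Fin l)) (v : Fin (l + m) → Ω) :
    zAvg ζ (v ∘ blockPerm l m σ) = zAvg ζ v := by
  funext i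
  have h : ∀ j : Fin l, (v ∘ blockPerm l m σ) ⟨j.1, by have := j.isLt; omega⟩
      = v (Fin.castAdd m (σ j)) := fun j => congrArg v (blockPerm_castAdd σ j)
  simp only [zAvg, h]
  congr 1
  exact Equiv.sum_comp σ (fun j => ζ (v (Fin.castAdd m j)) i)

/-- At most `m` windows of length `m` contain a given site. -/
theorem sum_window_indicator_le (l m a : ℕ) :
    ∑ j : Fin l, (if j.1 ≤ a ∧ a < j.1 + m then (1:ℝ) else 0) ≤ m := by
  rw [Finset.sum_boole]
  have h : (Finset.univ.filter fun j : Fin l => j.1 ≤ a ∧ a < j.1 + m).card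
      ≤ (Finset.range m).card := by
    refine Finset.card_le_card_of_injOn (fun j => a - j.1) ?_ ?_
    · intro j hj
      simp only [Finset.coe_filter, Finset.mem_univ, true_and, Set.mem_ofPred_eq] at hj
      simp only [Finset.coe_range, Set.mem_Iio]
      omega
    · intro i hi j hj hij
      simp only [Finset.coe_filter, Finset.mem_univ, true_and, Set.mem_ofPred_eq] at hi hj
      simp only at hij
      ext
      omega
  rw [Finset.card_range] at h
  exact_mod_cast h

theorem abs_xiAt_sub_le {Ω : Type} {m : ℕ} (ξ : (Fin m → Ω) → ℝ) (B : ℝ)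
    (hξ : ∀ w, |ξ w| ≤ B) {l : ℕ} (u v : Fin (l + m) → Ω) (a c : Fin (l + m))
    (huv : ∀ k, k ≠ a → k ≠ c → u k = v k) (j : Fin l) :
    |xiAt ξ u j - xiAt ξ v j| ≤ 2 * B * ((if j.1 ≤ a.1 ∧ a.1 < j.1 + m then 1 else 0)
      + (if j.1 ≤ c.1 ∧ c.1 < j.1 + m then 1 else 0)) := by
  have hbd : |xiAt ξ u j - xiAt ξ v j| ≤ 2 * B :=
    (abs_sub _ _).trans ((add_le_add (hξ _) (hξ _)).trans_eq (two_mul B).symm)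
  have hB : 0 ≤ 2 * B := (abs_nonneg _).trans hbd
  by_cases h1 : j.1 ≤ a.1 ∧ a.1 < j.1 + m
  · rw [if_pos h1]
    refine hbd.trans (le_mul_of_one_le_right hB ?_)
    split_ifs <;> norm_num
  by_cases h2 : j.1 ≤ c.1 ∧ c.1 < j.1 + m
  · rw [if_pos h2, if_neg h1]
    linarith
  have heq : xiAt ξ u j = xiAt ξ v j := by
    unfold xiAt
    congr 1
    funext i
    have := i.isLt
    apply huv
    · rintro rfl
      exact h1 ⟨by simp, by simp⟩
    · rintro rfl
      exact h2 ⟨by simp, by simp⟩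
  rw [heq, sub_self, abs_zero]
  refine mul_nonneg hB ?_
  split_ifs <;> norm_num

theorem abs_bAvg_sub_le {Ω : Type} (b : ℝ → ℝ) (Bb : ℝ) (hBb : ∀ s ∈ Set.Icc (0:ℝ) 1, |b s| ≤ Bb)
    {m : ℕ} (ξ : (Fin m → Ω) → ℝ) (B : ℝ) (hξ : ∀ w, |ξ w| ≤ B)
    {l : ℕ} (u v : Fin (l + m) → Ω) (a c : Fin (l + m))
    (huv : ∀ k, k ≠ a → k ≠ c → u k = v k) :
    |bAvg b ξ u - bAvg b ξ v| ≤ (l:ℝ)⁻¹ * (4 * m * B * Bb) := by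
  have hBb0 : 0 ≤ Bb := (abs_nonneg _).trans (hBb 0 (by simp))
  have hB0 : 0 ≤ B := (abs_nonneg _).trans (hξ (fun i => u (Fin.natAdd l i)))
  have hl0 : (0:ℝ) ≤ (l:ℝ)⁻¹ := by positivity
  unfold bAvg
  rw [← mul_sub, ← Finset.sum_sub_distrib, abs_mul, abs_of_nonneg hl0]
  refine mul_le_mul_of_nonneg_left ?_ hl0
  refine (Finset.abs_sum_le_sum_abs _ _).trans ?_
  calc _ ≤ ∑ j : Fin l, Bb * (2 * B * ((if j.1 ≤ a.1 ∧ a.1 < j.1 + m then 1 else 0)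
      + (if j.1 ≤ c.1 ∧ c.1 < j.1 + m then 1 else 0))) := by
        refine Finset.sum_le_sum fun j _ => ?_
        rw [← mul_sub, abs_mul]
        exact mul_le_mul (hBb _ (weight_point_mem_Icc j))
          (abs_xiAt_sub_le ξ B hξ u v a c huv j) (abs_nonneg _) hBb0
    _ = Bb * (2 * B) * (∑ j : Fin l, (if j.1 ≤ a.1 ∧ a.1 < j.1 + m then (1:ℝ) else 0)
      + ∑ j : Fin l, (if j.1 ≤ c.1 ∧ c.1 < j.1 + m then (1:ℝ) else 0)) := by
        rw [← Finset.sum_add_distrib, Finset.mul_sum]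
        exact Finset.sum_congr rfl fun j _ => by ring
    _ ≤ Bb * (2 * B) * (m + m) := by
        gcongr
        · exact sum_window_indicator_le l m a
        · exact sum_window_indicator_le l m c
    _ = _ := by ring

/-- Windows inside the block have the same average over all permutations of the block. -/
theorem sum_perm_xiAt_eq {Ω : Type} {m : ℕ} (ξ : (Fin m → Ω) → ℝ) {l : ℕ} (hl : 0 < l)
    (v : Fin (l + m) → Ω) (j : Fin l) (hj : j.1 + m ≤ l) :
    ∑ σ, xiAt ξ (v ∘ blockPerm l m σ) j = ∑ σ, xiAt ξ (v ∘ blockPerm l m σ) ⟨0, hl⟩ := by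
  have : NeZero l := ⟨hl.ne'⟩
  rw [← Equiv.sum_comp (Equiv.mulRight (Equiv.addLeft j))
    (fun σ => xiAt ξ (v ∘ blockPerm l m σ) ⟨0, hl⟩)]
  refine Finset.sum_congr rfl fun σ _ => ?_
  unfold xiAt
  congr 1
  funext i
  have hi := i.isLt
  have h1 : (⟨j.1 + i.1, by omega⟩ : Fin (l + m)) = Fin.castAdd m ⟨j.1 + i.1, by omega⟩ := rfl
  have h2 : (⟨(⟨0, hl⟩ : Fin l).1 + i.1, by omega⟩ : Fin (l + m))
      = Fin.castAdd m ⟨i.1, by omega⟩ := by ext; simp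
  simp only [Function.comp_apply]
  rw [h1, h2, blockPerm_castAdd, blockPerm_castAdd]
  congr 2
  simp only [Equiv.coe_mulRight, Equiv.Perm.coe_mul, Function.comp_apply, Equiv.coe_addLeft]
  congr 1
  ext
  rw [Fin.val_add, Nat.mod_eq_of_lt]
  simp only
  omega

theorem abs_sum_perm_bAvg_le {Ω : Type} (b : ℝ → ℝ) (Bb L : ℝ)
    (hBb : ∀ s ∈ Set.Icc (0:ℝ) 1, |b s| ≤ Bb)
    {m : ℕ} (ξ : (Fin m → Ω) → ℝ) (B : ℝ) (hξ : ∀ w, |ξ w| ≤ B)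
    {l : ℕ} (hl : 0 < l) (hL : |∑ j : Fin l, b (((j.1 : ℝ) + 1) / l)| ≤ L)
    (v : Fin (l + m) → Ω) :
    |(∑ σ, bAvg b ξ (v ∘ blockPerm l m σ)) / l.factorial|
      ≤ (l:ℝ)⁻¹ * (B * (L + 2 * m * Bb)) := by
  have hBb0 : 0 ≤ Bb := (abs_nonneg _).trans (hBb 0 (by simp))
  have hB0 : 0 ≤ B := (abs_nonneg _).trans (hξ (fun i => v (Fin.natAdd l i)))
  have hl0 : (0:ℝ) ≤ (l:ℝ)⁻¹ := by positivity
  have hn : (0:ℝ) < l.factorial := by exact_mod_cast l.factorial_pos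
  let T : Fin l → ℝ := fun j => (∑ σ, xiAt ξ (v ∘ blockPerm l m σ) j) / l.factorial
  have hT : ∀ j, |T j| ≤ B := by
    intro j
    simp only [T]
    rw [abs_div, abs_of_pos hn, div_le_iff₀ hn]
    refine (Finset.abs_sum_le_sum_abs _ _).trans
      ((Finset.sum_le_sum fun σ _ => hξ _).trans (le_of_eq ?_))
    simp [Fintype.card_perm, mul_comm]
  have hT0 : ∀ j : Fin l, j.1 + m ≤ l → T j = T ⟨0, hl⟩ := by
    intro j hj
    simp only [T]
    rw [sum_perm_xiAt_eq ξ hl v j hj]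
  have hswap : (∑ σ, bAvg b ξ (v ∘ blockPerm l m σ)) / l.factorial
      = (l:ℝ)⁻¹ * (T ⟨0, hl⟩ * ∑ j : Fin l, b (((j.1 : ℝ) + 1) / l)
        + ∑ j : Fin l, b (((j.1 : ℝ) + 1) / l) * (T j - T ⟨0, hl⟩)) := by
    have h1 : T ⟨0, hl⟩ * ∑ j : Fin l, b (((j.1 : ℝ) + 1) / l)
        + ∑ j : Fin l, b (((j.1 : ℝ) + 1) / l) * (T j - T ⟨0, hl⟩)
        = ∑ j : Fin l, b (((j.1 : ℝ) + 1) / l) * T j := by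
      rw [Finset.mul_sum, ← Finset.sum_add_distrib]
      exact Finset.sum_congr rfl fun j _ => by ring
    rw [h1]
    simp only [bAvg, T]
    rw [← Finset.mul_sum, mul_div_assoc, Finset.sum_comm, Finset.sum_div]
    simp only [← Finset.mul_sum, mul_div_assoc]
  rw [hswap, abs_mul, abs_of_nonneg hl0]
  refine mul_le_mul_of_nonneg_left ?_ hl0
  have hfirst : |T ⟨0, hl⟩ * ∑ j : Fin l, b (((j.1 : ℝ) + 1) / l)| ≤ B * L := by
    rw [abs_mul]
    exact mul_le_mul (hT _) hL (abs_nonneg _) hB0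
  have hsecond : |∑ j : Fin l, b (((j.1 : ℝ) + 1) / l) * (T j - T ⟨0, hl⟩)|
      ≤ Bb * (2 * B) * m := by
    refine (Finset.abs_sum_le_sum_abs _ _).trans ?_
    calc _ ≤ ∑ j : Fin l, Bb * (2 * B) * (if j.1 ≤ l ∧ l < j.1 + m then (1:ℝ) else 0) := by
          refine Finset.sum_le_sum fun j _ => ?_
          split_ifs with h
          · rw [abs_mul, mul_one]
            refine mul_le_mul (hBb _ (weight_point_mem_Icc j)) ?_ (abs_nonneg _) hBb0
            exact (abs_sub _ _).trans (by linarith [hT j, hT ⟨0, hl⟩])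
          · rw [hT0 j (by have := j.isLt; omega)]
            simp
      _ ≤ _ := by
          rw [← Finset.mul_sum]
          exact mul_le_mul_of_nonneg_left (sum_window_indicator_le l m l) (by positivity)
  refine (abs_add_le _ _).trans ((add_le_add hfirst hsecond).trans (le_of_eq (by ring)))

/-- If every configuration satisfies an upper bound on average over the permutations of the
block, then so does the microcanonical expectation. -/
theorem condExp_le_of_perm_average_le {Ω : Type} [Fintype Ω] (π : Ω → ℝ) (hπ0 : ∀ ω, 0 ≤ π ω)
    {d l m : ℕ} (ζ : Ω → Fin d → ℝ) (x : Fin d → ℝ)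
    (hx : 0 < ∑ σ : Fin (l + m) → Ω, if zAvg ζ σ = x then wt π σ else 0)
    (f : (Fin (l + m) → Ω) → ℝ) (A : ℝ)
    (hf : ∀ v, ∑ σ, f (v ∘ blockPerm l m σ) ≤ l.factorial * A) :
    condExp π ζ x f ≤ A := by
  have hn : (0:ℝ) < l.factorial := by exact_mod_cast l.factorial_pos
  unfold condExp
  rw [div_le_iff₀ hx]
  let W : (Fin (l + m) → Ω) → ℝ := fun v => if zAvg ζ v = x then wt π v else 0
  have hW0 : ∀ v, 0 ≤ W v := by
    intro v
    simp only [W]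
    split_ifs
    · exact Finset.prod_nonneg fun i _ => hπ0 _
    · exact le_rfl
  have hWinv : ∀ σ v, W (v ∘ blockPerm l m σ) = W v := by
    intro σ v
    simp only [W, zAvg_comp_blockPerm, wt_comp_blockPerm]
  have hnum : (∑ v : Fin (l + m) → Ω, if zAvg ζ v = x then wt π v * f v else 0)
      = ∑ v, W v * f v := by
    refine Finset.sum_congr rfl fun v _ => ?_
    simp only [W, ite_mul, zero_mul]
  have hinv : ∀ σ : Equiv.Perm (Fin l),
      ∑ v, W v * f (v ∘ blockPerm l m σ) = ∑ v, W v * f v := by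
    intro σ
    rw [← Equiv.sum_comp (Equiv.arrowCongr (blockPerm l m σ)⁻¹ (Equiv.refl Ω))
      (fun v => W v * f v)]
    refine Finset.sum_congr rfl fun v _ => ?_
    have : Equiv.arrowCongr (blockPerm l m σ)⁻¹ (Equiv.refl Ω) v = v ∘ blockPerm l m σ := by
      ext k; rfl
    rw [this, hWinv]
  rw [hnum]
  refine le_of_mul_le_mul_left ?_ hn
  calc (l.factorial:ℝ) * ∑ v, W v * f v
      = ∑ σ : Equiv.Perm (Fin l), ∑ v, W v * f (v ∘ blockPerm l m σ) := by
        simp [hinv, Fintype.card_perm]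
    _ = ∑ v, W v * ∑ σ, f (v ∘ blockPerm l m σ) := by
        rw [Finset.sum_comm]
        simp only [Finset.mul_sum]
    _ ≤ ∑ v, W v * (l.factorial * A) :=
        Finset.sum_le_sum fun v _ => mul_le_mul_of_nonneg_left (hf v) (hW0 v)
    _ = _ := by
        rw [← Finset.sum_mul]
        ring

/-- Microcanonical exponential moments of weighted block averages, part (i):
if ∫₀¹ b = 0 then E[exp{γ√l⟨b,ξ⟩_l} | ζ̄_l = x] ≤ exp{C(γ² + |γ|/√l)}
uniformly in l and x. -/
theorem stmt_16 {Ω : Type} [Fintype Ω] [Nonempty Ω]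
    (π : Ω → ℝ) (hπ0 : ∀ ω, 0 ≤ π ω) (hπ1 : ∑ ω, π ω = 1)
    (d m : ℕ) (ζ : Ω → Fin d → ℝ) (ξ : (Fin m → Ω) → ℝ)
    (b : ℝ → ℝ) (hb : ContDiff ℝ (⊤ : ℕ∞) b)
    (hb0 : (∫ s in (0:ℝ)..1, b s) = 0) :
    ∃ C : ℝ, ∀ l : ℕ, 0 < l → ∀ x : Fin d → ℝ,
      (0 < ∑ σ : Fin (l + m) → Ω, if zAvg ζ σ = x then wt π σ else 0) →
      ∀ γ : ℝ,
        condExp π ζ x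
            (fun σ : Fin (l + m) → Ω =>
              Real.exp (γ * Real.sqrt l * bAvg b ξ σ))
          ≤ Real.exp (C * (γ^2 + |γ| / Real.sqrt l)) := by
  have hbc : ContinuousOn b (Set.Icc (0:ℝ) 1) := hb.continuous.continuousOn
  obtain ⟨Bb, hBb⟩ := isCompact_Icc.exists_bound_of_continuousOn hbc
  simp only [Real.norm_eq_abs] at hBb
  obtain ⟨L, hL0, hL⟩ := exists_riemann_sum_bound b hb hb0
  obtain ⟨B, hξ⟩ : ∃ B : ℝ, ∀ w, |ξ w| ≤ B :=
    ⟨∑ w, |ξ w|, fun w => Finset.single_le_sum (fun w _ => abs_nonneg (ξ w)) (Finset.mem_univ w)⟩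
  have hBb0 : 0 ≤ Bb := (abs_nonneg _).trans (hBb 0 (by simp))
  have hB0 : 0 ≤ B := (abs_nonneg _).trans (hξ (fun _ => Classical.arbitrary Ω))
  set K : ℝ := 4 * m * B * Bb with hK
  set R : ℝ := B * (L + 2 * m * Bb) with hR
  have hR0 : 0 ≤ R := by positivity
  refine ⟨R + 2 * K ^ 2, fun l hl x hx γ => ?_⟩
  have hl' : (0:ℝ) < l := by exact_mod_cast hl
  have hs : 0 < Real.sqrt l := Real.sqrt_pos.2 hl'
  have hss : Real.sqrt l * Real.sqrt l = l := Real.mul_self_sqrt hl'.le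
  have hsinv : Real.sqrt l * (l:ℝ)⁻¹ = 1 / Real.sqrt l := by
    field_simp
    rw [sq, hss]
  refine condExp_le_of_perm_average_le π hπ0 ζ x hx _ _ fun v => ?_
  set c : ℝ := |γ| / Real.sqrt l * K with hc
  have hlip : ∀ i j σ,
      |γ * Real.sqrt l * bAvg b ξ (v ∘ blockPerm l m (Equiv.swap i j * σ))
        - γ * Real.sqrt l * bAvg b ξ (v ∘ blockPerm l m σ)| ≤ c := by
    intro i j σ
    rw [← mul_sub, abs_mul, abs_mul, abs_of_pos hs]
    have h := abs_bAvg_sub_le b Bb hBb ξ B hξ (v ∘ blockPerm l m (Equiv.swap i j * σ))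
      (v ∘ blockPerm l m σ) (Fin.castAdd m (σ⁻¹ i)) (Fin.castAdd m (σ⁻¹ j)) (by
        intro k
        refine Fin.addCases (fun k => ?_) (fun k => ?_) k
        · intro hi hj
          simp only [Function.comp_apply, blockPerm_castAdd, Equiv.Perm.coe_mul]
          rw [Equiv.swap_apply_of_ne_of_ne]
          · rintro rfl
            simp at hi
          · rintro rfl
            simp at hj
        · intro _ _
          simp only [Function.comp_apply, blockPerm_natAdd])
    calc _ ≤ |γ| * Real.sqrt l * ((l:ℝ)⁻¹ * K) :=
          mul_le_mul_of_nonneg_left h (by positivity)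
      _ = |γ| * (Real.sqrt l * (l:ℝ)⁻¹) * K := by ring
      _ = c := by rw [hsinv, hc]; ring
  refine (sum_exp_perm_le _ c hlip).trans ?_
  refine mul_le_mul_of_nonneg_left (Real.exp_le_exp.2 ?_) (by positivity)
  have hmean : (∑ σ, γ * Real.sqrt l * bAvg b ξ (v ∘ blockPerm l m σ)) / l.factorial
      ≤ |γ| / Real.sqrt l * R := by
    rw [← Finset.mul_sum, mul_div_assoc]
    refine (le_abs_self _).trans ?_
    rw [abs_mul, abs_mul, abs_of_pos hs]
    calc _ ≤ |γ| * Real.sqrt l * ((l:ℝ)⁻¹ * R) :=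
          mul_le_mul_of_nonneg_left (abs_sum_perm_bAvg_le b Bb L hBb ξ B hξ hl (hL l hl) v)
            (by positivity)
      _ = |γ| * (Real.sqrt l * (l:ℝ)⁻¹) * R := by ring
      _ = _ := by rw [hsinv]; ring
  have hvar : (l:ℝ) * (2 * c ^ 2) = 2 * K ^ 2 * γ ^ 2 := by
    rw [hc, mul_pow, div_pow, sq_abs, sq (Real.sqrt l), hss]
    field_simp
  rw [hvar]
  have h1 : 0 ≤ |γ| / Real.sqrt l := by positivity
  have h2 : 0 ≤ R * γ ^ 2 := by positivity
  have h3 : 0 ≤ 2 * K ^ 2 * (|γ| / Real.sqrt l) := by positivity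
  nlinarith
end
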